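/- If G is a graph in obs(P1) that is not isomorphic to any of the 33 graphs in O, then either the complete bipartite graph K(2,3) is not a minor of G, or G is biconnected. -/

import Mathlib

open SimpleGraph

/-- `H` is a minor of `G` (branch-set definition): there is a family of connected, nonempty,
pairwise disjoint branch sets in `G`, indexed by the vertices of `H`, such that vertices
adjacent in `H` have an edge of `G` between their branch sets. -/
def IsMinorOf {W V : Type} (H : SimpleGraph W) (G : SimpleGraph V) : Prop :=
  ∃ f : W → Set V,
    (∀ w, (G.induce (f w)).Connected) ∧
    (∀ ⦃w w' : W⦄, w ≠ w' → Disjoint (f w) (f w')) ∧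
    (∀ ⦃w w' : W⦄, H.Adj w w' → ∃ a ∈ f w, ∃ b ∈ f w', G.Adj a b)

/-- A pseudoforest: every connected component contains at most one cycle, i.e. any two
cycles lying in the same connected component have the same edge set. -/
def Pseudoforest {V : Type} (G : SimpleGraph V) : Prop :=
  ∀ ⦃u v : V⦄ (c : G.Walk u u) (c' : G.Walk v v),
    c.IsCycle → c'.IsCycle → G.Reachable u v → ∀ e, e ∈ c.edges ↔ e ∈ c'.edges

/-- An apex-pseudoforest: removing at most one vertex yields a pseudoforest. -/
def ApexPseudoforest {V : Type} (G : SimpleGraph V) : Prop :=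
  ∃ s : Set V, s.Subsingleton ∧ Pseudoforest (G.induce sᶜ)

/-- `G` is a minor-obstruction for the class of apex-pseudoforests: `G` is not an
apex-pseudoforest but every proper minor of `G` is. -/
def ObsApexPseudoforest {V : Type} (G : SimpleGraph V) : Prop :=
  ¬ ApexPseudoforest G ∧
    ∀ (W : Type) [Finite W] (H : SimpleGraph W),
      IsMinorOf H G → IsEmpty (H ≃g G) → ApexPseudoforest H

/-- `G` is `k`-connected: between any two distinct vertices `u ≠ v` there exist `k`
pairwise distinct `(u,v)`-paths, any two of which share no vertices other than `u,v`. -/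
def KConnected {V : Type} (k : ℕ) (G : SimpleGraph V) : Prop :=
  ∀ ⦃u v : V⦄, u ≠ v → ∃ P : Fin k → G.Walk u v,
    Function.Injective P ∧ (∀ i, (P i).IsPath) ∧
      ∀ i j, i ≠ j → ∀ x, x ∈ (P i).support → x ∈ (P j).support → x = u ∨ x = v

/-- The simple graph on `Fin n` with the given list of (0-indexed) edges. -/
def mkGraph (n : ℕ) (E : List (ℕ × ℕ)) : SimpleGraph (Fin n) :=
  SimpleGraph.fromRel fun a b => ((a : ℕ), (b : ℕ)) ∈ E

/-- Obstruction 1: two disjoint diamonds. -/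
def O1 : SimpleGraph (Fin 8) :=
  mkGraph 8 [(0,1),(0,2),(0,3),(1,2),(1,3),(4,5),(4,6),(4,7),(5,6),(5,7)]
/-- Obstruction 2: two disjoint butterflies. -/
def O2 : SimpleGraph (Fin 10) :=
  mkGraph 10 [(0,1),(0,2),(1,2),(0,3),(0,4),(3,4),(5,6),(5,7),(6,7),(5,8),(5,9),(8,9)]
/-- Obstruction 3: a diamond plus a butterfly. -/
def O3 : SimpleGraph (Fin 9) :=
  mkGraph 9 [(0,1),(0,2),(0,3),(1,2),(1,3),(4,5),(4,6),(5,6),(4,7),(4,8),(7,8)]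
def O4 : SimpleGraph (Fin 8) :=
  mkGraph 8 [(0,1),(0,2),(1,2),(2,3),(2,4),(3,4),(3,5),(4,5),(5,6),(5,7),(6,7)]
def O5 : SimpleGraph (Fin 8) :=
  mkGraph 8 [(0,1),(0,2),(1,2),(2,3),(2,4),(3,4),(3,5),(4,6),(5,6),(5,7),(6,7)]
def O6 : SimpleGraph (Fin 8) :=
  mkGraph 8 [(0,1),(0,2),(1,2),(2,3),(2,4),(3,4),(3,5),(4,5),(3,6),(5,6),(4,7),(5,7)]
def O7 : SimpleGraph (Fin 7) :=
  mkGraph 7 [(0,1),(0,6),(1,6),(2,3),(2,4),(2,5),(3,4),(3,5),(4,6),(5,6)]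
def O8 : SimpleGraph (Fin 7) :=
  mkGraph 7 [(0,1),(0,2),(1,2),(2,3),(2,4),(2,5),(3,4),(3,5),(4,5),(4,6),(5,6)]
def O9 : SimpleGraph (Fin 9) :=
  mkGraph 9 [(0,1),(0,2),(1,2),(2,3),(2,4),(3,4),(3,5),(4,5),(2,6),(4,6),(2,7),(3,7),(3,8),(4,8)]
def O10 : SimpleGraph (Fin 9) :=
  mkGraph 9 [(0,1),(1,2),(2,3),(3,0),(0,4),(1,4),(1,5),(2,5),(2,6),(3,6),(0,7),(0,8),(7,8)]
def O11 : SimpleGraph (Fin 9) :=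
  mkGraph 9 [(0,1),(0,2),(1,2),(3,4),(3,5),(4,5),(6,7),(6,8),(7,8),(2,3),(1,8),(4,8)]
def O12 : SimpleGraph (Fin 9) :=
  mkGraph 9 [(0,1),(0,2),(1,2),(3,4),(3,5),(4,5),(6,7),(6,8),(7,8),(2,3),(2,7),(3,6)]
def O13 : SimpleGraph (Fin 9) :=
  mkGraph 9 [(0,1),(0,2),(1,2),(3,4),(3,5),(4,5),(6,7),(6,8),(7,8),(2,3),(2,8),(3,8)]
def O14 : SimpleGraph (Fin 8) :=
  mkGraph 8 [(0,1),(0,2),(1,2),(1,4),(2,3),(2,4),(3,4),(3,5),(4,5),(1,6),(1,7),(6,7)]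
def O15 : SimpleGraph (Fin 9) :=
  mkGraph 9 [(0,1),(0,2),(1,2),(2,3),(2,4),(3,4),(4,5),(4,6),(5,6),(6,7),(6,8),(7,8),(2,6)]
def O16 : SimpleGraph (Fin 6) :=
  mkGraph 6 [(0,2),(0,3),(0,4),(0,5),(1,2),(1,3),(1,4),(1,5),(2,3),(4,5)]
def O17 : SimpleGraph (Fin 6) :=
  mkGraph 6 [(0,1),(1,3),(3,2),(2,0),(4,0),(4,1),(4,2),(4,3),(5,0),(5,1)]
def O18 : SimpleGraph (Fin 8) :=
  mkGraph 8 [(0,1),(1,2),(2,3),(3,0),(4,0),(4,1),(5,1),(5,2),(6,2),(6,3),(7,3),(7,0)]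
def O19 : SimpleGraph (Fin 7) :=
  mkGraph 7 [(0,2),(0,3),(1,2),(1,3),(2,3),(0,4),(4,1),(5,0),(5,4),(6,4),(6,1)]
def O20 : SimpleGraph (Fin 6) :=
  mkGraph 6 [(1,2),(1,4),(1,5),(2,4),(2,5),(4,5),(0,1),(0,4),(2,3),(3,5)]
def O21 : SimpleGraph (Fin 7) :=
  mkGraph 7 [(0,1),(0,3),(0,4),(1,3),(1,4),(3,5),(4,5),(1,2),(2,4),(3,6),(5,6)]
def O22 : SimpleGraph (Fin 8) :=
  mkGraph 8 [(0,1),(0,3),(1,4),(3,4),(1,2),(2,4),(7,0),(7,3),(5,7),(5,0),(6,7),(6,3)]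
def O23 : SimpleGraph (Fin 7) :=
  mkGraph 7 [(2,3),(2,4),(2,6),(3,4),(3,6),(4,6),(5,3),(5,4),(0,2),(0,3),(1,2),(1,4)]
def O24 : SimpleGraph (Fin 7) :=
  mkGraph 7 [(0,1),(0,2),(1,2),(1,3),(2,4),(3,5),(3,6),(4,5),(4,6),(5,6)]
def O25 : SimpleGraph (Fin 8) :=
  mkGraph 8 [(0,1),(0,3),(1,3),(1,2),(1,5),(2,5),(1,7),(2,7),(3,4),(4,5),(3,5),(3,6),(5,6)]
def O26 : SimpleGraph (Fin 9) :=
  mkGraph 9 [(2,3),(2,4),(3,4),(5,3),(5,4),(8,3),(8,4),(0,2),(0,3),(7,2),(7,3),(1,2),(1,4),(6,2),(6,4)]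
def O27 : SimpleGraph (Fin 8) :=
  mkGraph 8 [(0,2),(1,2),(0,3),(2,3),(1,6),(2,6),(3,4),(6,7),(4,5),(5,7),(3,7),(4,7)]
def O28 : SimpleGraph (Fin 7) :=
  mkGraph 7 [(0,1),(0,2),(1,2),(1,3),(1,5),(3,5),(3,4),(3,6),(4,6),(2,5),(5,6)]
def O29 : SimpleGraph (Fin 9) :=
  mkGraph 9 [(0,1),(0,2),(1,2),(3,4),(3,5),(4,5),(6,7),(6,8),(7,8),(2,3),(1,7),(4,6)]
def O30 : SimpleGraph (Fin 8) :=
  mkGraph 8 [(0,1),(0,2),(1,2),(3,4),(3,5),(4,5),(6,7),(1,6),(4,6),(0,7),(5,7)]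
/-- Obstruction 31: the prism. -/
def O31 : SimpleGraph (Fin 6) :=
  mkGraph 6 [(0,1),(0,2),(1,2),(3,4),(3,5),(4,5),(0,3),(1,4),(2,5)]
/-- Obstruction 32: `K₃,₃`. -/
def O32 : SimpleGraph (Fin 6) :=
  mkGraph 6 [(0,3),(0,4),(0,5),(1,3),(1,4),(1,5),(2,3),(2,4),(2,5)]
/-- Obstruction 33: `K₅` minus one edge. -/
def O33 : SimpleGraph (Fin 5) :=
  mkGraph 5 [(0,1),(0,2),(0,3),(0,4),(1,2),(1,3),(1,4),(2,3),(2,4)]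

/-- The list `O` of the 33 obstructions. -/
def OList : List ((n : ℕ) × SimpleGraph (Fin n)) :=
  [⟨8, O1⟩, ⟨10, O2⟩, ⟨9, O3⟩, ⟨8, O4⟩, ⟨8, O5⟩, ⟨8, O6⟩, ⟨7, O7⟩, ⟨7, O8⟩, ⟨9, O9⟩,
   ⟨9, O10⟩, ⟨9, O11⟩, ⟨9, O12⟩, ⟨9, O13⟩, ⟨8, O14⟩, ⟨9, O15⟩, ⟨6, O16⟩, ⟨6, O17⟩,
   ⟨8, O18⟩, ⟨7, O19⟩, ⟨6, O20⟩, ⟨7, O21⟩, ⟨8, O22⟩, ⟨7, O23⟩, ⟨7, O24⟩, ⟨8, O25⟩,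
   ⟨9, O26⟩, ⟨8, O27⟩, ⟨7, O28⟩, ⟨9, O29⟩, ⟨8, O30⟩, ⟨6, O31⟩, ⟨6, O32⟩, ⟨5, O33⟩]

/-- `G` is isomorphic to one of the 33 graphs in `O`. -/
def InO {V : Type} (G : SimpleGraph V) : Prop :=
  ∃ H ∈ OList, Nonempty (G ≃g H.2)

section

variable {V : Type} {G : SimpleGraph V}

/-- `S` is nonempty and induces a connected subgraph of `G`. -/
def ConnSet (G : SimpleGraph V) (S : Set V) : Prop :=
  S.Nonempty ∧ ∀ T ⊆ S, T.Nonempty → (∀ a ∈ T, ∀ b ∈ S, G.Adj a b → b ∈ T) → T = S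

/-- There is an edge of `G` from `S` to `T`. -/
def Touch (G : SimpleGraph V) (S T : Set V) : Prop := ∃ a ∈ S, ∃ b ∈ T, G.Adj a b

theorem Touch.symm {S T : Set V} (h : Touch G S T) : Touch G T S := by
  obtain ⟨a, ha, b, hb, hab⟩ := h
  exact ⟨b, hb, a, ha, hab.symm⟩

theorem touch_comm {S T : Set V} : Touch G S T ↔ Touch G T S := ⟨Touch.symm, Touch.symm⟩

theorem Touch.mono {S S' T T' : Set V} (h : Touch G S T) (hS : S ⊆ S') (hT : T ⊆ T') :
    Touch G S' T' := by
  obtain ⟨a, ha, b, hb, hab⟩ := h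
  exact ⟨a, hS ha, b, hT hb, hab⟩

theorem touch_union_left {S S' T : Set V} :
    Touch G (S ∪ S') T ↔ Touch G S T ∨ Touch G S' T := by
  constructor
  · rintro ⟨a, ha | ha, b, hb, hab⟩
    · exact Or.inl ⟨a, ha, b, hb, hab⟩
    · exact Or.inr ⟨a, ha, b, hb, hab⟩
  · rintro (h | h)
    · exact h.mono Set.subset_union_left subset_rfl
    · exact h.mono Set.subset_union_right subset_rfl

theorem touch_union_right {S S' T : Set V} :
    Touch G T (S ∪ S') ↔ Touch G T S ∨ Touch G T S' := by
  simp only [touch_comm (S := T), touch_union_left]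

theorem connSet_iff {S : Set V} : ConnSet G S ↔ (G.induce S).Connected := by
  constructor
  · rintro ⟨⟨x, hx⟩, h⟩
    have : Nonempty S := ⟨⟨x, hx⟩⟩
    refine ⟨fun a b => ?_⟩
    have key := h {y | ∃ hy : y ∈ S, (G.induce S).Reachable a ⟨y, hy⟩} (fun y hy => hy.1)
      ⟨a, a.2, Reachable.refl _⟩ (by
        rintro y ⟨hy, hr⟩ z hz hyz
        refine ⟨hz, hr.trans (Adj.reachable ?_)⟩
        simpa using hyz)
    have hb : (b : V) ∈ {y | ∃ hy : y ∈ S, (G.induce S).Reachable a ⟨y, hy⟩} := key.ge b.2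
    exact hb.2
  · intro h
    obtain ⟨x⟩ := h.nonempty
    refine ⟨⟨x, x.2⟩, fun T hT ⟨t, ht⟩ hcl => hT.antisymm fun b hb => ?_⟩
    obtain ⟨w⟩ := h.preconnected ⟨t, hT ht⟩ ⟨b, hb⟩
    have : ∀ (a c : S), (G.induce S).Walk a c → (a : V) ∈ T → (c : V) ∈ T := by
      intro a c w
      induction w with
      | nil => exact id
      | cons hadj _ ih => exact fun ha => ih (hcl _ ha _ (Subtype.prop _) (by simpa using hadj))
    exact this _ _ w ht

theorem ConnSet.eq_of_closed {S T : Set V} (h : ConnSet G S) (hT : T ⊆ S) (hne : T.Nonempty)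
    (hcl : ∀ a ∈ T, ∀ b ∈ S, G.Adj a b → b ∈ T) : T = S := h.2 T hT hne hcl

theorem connSet_singleton (x : V) : ConnSet G {x} := by
  refine ⟨⟨x, rfl⟩, fun T hT ⟨t, ht⟩ _ => hT.antisymm ?_⟩
  rintro y rfl
  have := hT ht
  simp_all

/-- A nonempty proper subset of a connected set touches its complement in that set. -/
theorem ConnSet.touch_diff {S T : Set V} (h : ConnSet G S) (hT : T ⊆ S) (hne : T.Nonempty)
    (hne' : (S \ T).Nonempty) : Touch G T (S \ T) := by
  by_contra hcon
  obtain ⟨x, hx, hxT⟩ := hne'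
  refine hxT ?_
  rw [h.eq_of_closed hT hne fun a ha b hb hab => ?_]
  · exact hx
  · by_contra hbT
    exact hcon ⟨a, ha, b, ⟨hb, hbT⟩, hab⟩

theorem ConnSet.touch_of_union {S T : Set V} (h : ConnSet G (S ∪ T)) (hd : Disjoint S T)
    (hS : S.Nonempty) (hT : T.Nonempty) : Touch G S T := by
  have : (S ∪ T) \ S = T := by
    rw [Set.union_sdiff_left]; exact hd.symm.sdiff_eq_left
  have h2 := h.touch_diff Set.subset_union_left hS (by rwa [this])
  rwa [this] at h2

theorem ConnSet.union {S T : Set V} (hS : ConnSet G S) (hT : ConnSet G T)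
    (h : Touch G S T ∨ (S ∩ T).Nonempty) : ConnSet G (S ∪ T) := by
  refine ⟨hS.1.mono Set.subset_union_left, fun U hU hne hcl => hU.antisymm ?_⟩
  have h1 : (U ∩ S).Nonempty → S ⊆ U := fun hn => by
    have := hS.eq_of_closed Set.inter_subset_right hn fun a ha b hb hab =>
      ⟨hcl a ha.1 b (Or.inl hb) hab, hb⟩
    exact this ▸ Set.inter_subset_left
  have h2 : (U ∩ T).Nonempty → T ⊆ U := fun hn => by
    have := hT.eq_of_closed Set.inter_subset_right hn fun a ha b hb hab =>
      ⟨hcl a ha.1 b (Or.inr hb) hab, hb⟩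
    exact this ▸ Set.inter_subset_left
  have h12 : S ⊆ U ↔ T ⊆ U := by
    rcases h with ⟨a, ha, b, hb, hab⟩ | ⟨x, hxS, hxT⟩
    · exact ⟨fun hs => h2 ⟨b, hcl a (hs ha) b (Or.inr hb) hab, hb⟩,
        fun ht => h1 ⟨a, hcl b (ht hb) a (Or.inl ha) hab.symm, ha⟩⟩
    · exact ⟨fun hs => h2 ⟨x, hs hxS, hxT⟩, fun ht => h1 ⟨x, ht hxT, hxS⟩⟩
  obtain ⟨x, hx⟩ := hne
  rcases hU hx with hxS | hxT
  · have := h1 ⟨x, hx, hxS⟩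
    exact Set.union_subset this (h12.1 this)
  · have := h2 ⟨x, hx, hxT⟩
    exact Set.union_subset (h12.2 this) this

theorem ConnSet.union_touch {S T : Set V} (hS : ConnSet G S) (hT : ConnSet G T)
    (h : Touch G S T) : ConnSet G (S ∪ T) := hS.union hT (Or.inl h)

theorem ConnSet.union_singleton {S : Set V} (hS : ConnSet G S) {x y : V} (hy : y ∈ S)
    (h : G.Adj y x) : ConnSet G (S ∪ {x}) :=
  hS.union_touch (connSet_singleton x) ⟨y, hy, x, rfl, h⟩

/-- The component, inside `U`, of a connected set. -/
theorem ConnSet.exists_comp [Finite V] {S U : Set V} (hS : ConnSet G S) (hSU : S ⊆ U) :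
    ∃ K, S ⊆ K ∧ K ⊆ U ∧ ConnSet G K ∧ ∀ a ∈ K, ∀ b ∈ U, G.Adj a b → b ∈ K := by
  obtain ⟨K, hSK, hK⟩ := Set.Finite.exists_le_maximal
    (Set.toFinite {K : Set V | S ⊆ K ∧ K ⊆ U ∧ ConnSet G K}) ⟨subset_rfl, hSU, hS⟩
  refine ⟨K, hSK, hK.prop.2.1, hK.prop.2.2, fun a ha b hb hab => ?_⟩
  have : K ∪ {b} ⊆ K := hK.le_of_ge (y := K ∪ {b})
    ⟨hSK.trans Set.subset_union_left, Set.union_subset hK.prop.2.1 (by simpa using hb),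
      hK.prop.2.2.union_singleton ha hab⟩ Set.subset_union_left
  exact this (Or.inr rfl)

/-- Removing from a connected set a component of the complement of a connected subset
leaves a connected set. -/
theorem ConnSet.diff_comp [Finite V] {S A K : Set V} (hS : ConnSet G S) (hA : ConnSet G A)
    (hAS : A ⊆ S) (hKA : Disjoint K A)
    (hcl : ∀ a ∈ K, ∀ b ∈ S \ A, G.Adj a b → b ∈ K) : ConnSet G (S \ K) := by
  have hAK : A ⊆ S \ K := fun x hx => ⟨hAS hx, fun hk => hKA.le_bot ⟨hk, hx⟩⟩
  obtain ⟨C, hAC, hCU, hC, hCcl⟩ := hA.exists_comp hAK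
  convert hC using 1
  refine Set.Subset.antisymm (fun x hx => ?_) hCU
  by_contra hxC
  obtain ⟨a, ⟨haS, ha⟩, b, hb, hab⟩ := hS.touch_diff (T := (S \ K) \ C)
    (fun y hy => hy.1.1) ⟨x, hx, hxC⟩
    ⟨_, hAS hA.1.some_mem, fun h => h.2 (hAC hA.1.some_mem)⟩
  by_cases hbK : b ∈ K
  · exact haS.2 (hcl b hbK a ⟨haS.1, fun h => ha (hAC h)⟩ hab.symm)
  · have hbC : b ∈ C := by
      by_contra h
      exact hb.2 ⟨⟨hb.1, hbK⟩, h⟩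
    exact ha (hCcl b hbC a haS hab.symm)

/-- A connected set with two marked vertices splits into two connected parts separating them. -/
theorem ConnSet.split [Finite V] {S : Set V} (hS : ConnSet G S) {a b : V} (ha : a ∈ S)
    (hb : b ∈ S) (hab : a ≠ b) : ∃ X Y, S = X ∪ Y ∧ Disjoint X Y ∧ a ∈ X ∧ b ∈ Y ∧
      ConnSet G X ∧ ConnSet G Y ∧ Touch G X Y := by
  obtain ⟨K, hK1, hK2, hK3, hK4⟩ := (connSet_singleton (G := G) b).exists_comp (U := S \ {a})
    (by simpa using ⟨hb, hab.symm⟩)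
  have hKa : a ∉ K := fun h => (hK2 h).2 rfl
  have hbK : b ∈ K := hK1 rfl
  have hc : ConnSet G (S \ K) := hS.diff_comp (connSet_singleton a) (by simpa using ha)
    (by simpa using hKa) hK4
  have hKS : K ⊆ S := hK2.trans Set.sdiff_subset
  have heq : S = S \ K ∪ K := (Set.sdiff_union_of_subset hKS).symm
  refine ⟨S \ K, K, heq, Set.disjoint_sdiff_left, ⟨ha, hKa⟩, hbK, hc, hK3, ?_⟩
  exact (heq ▸ hS).touch_of_union Set.disjoint_sdiff_left hc.1 hK3.1

theorem ConnSet.exists_noncut [Finite V] {S : Set V} (hS : ConnSet G S) (h : S.Nontrivial) :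
    ∃ y ∈ S, ConnSet G (S \ {y}) ∧ ∃ z ∈ S \ {y}, G.Adj z y := by
  obtain ⟨x, hx, y, hy, hxy⟩ := h
  obtain ⟨T, -, hT⟩ := Set.Finite.exists_le_maximal
    (Set.toFinite {K : Set V | K ⊆ S ∧ K ≠ S ∧ ConnSet G K}) (a := {x})
    ⟨by simpa using hx, fun h => hxy (by rw [← h] at hy; simpa using hy.symm),
      connSet_singleton x⟩
  have hne : (S \ T).Nonempty := by
    rw [Set.sdiff_nonempty]
    exact fun h => hT.prop.2.1 (hT.prop.1.antisymm h)
  obtain ⟨a, ha, b, hb, hab⟩ := hS.touch_diff hT.prop.1 hT.prop.2.2.1 hne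
  have hTb := hT.prop.2.2.union_singleton ha hab
  have hTS : T ∪ {b} = S := by
    by_contra hcon
    exact hb.2 (hT.le_of_ge ⟨Set.union_subset hT.prop.1 (by simpa using hb.1), hcon, hTb⟩
      Set.subset_union_left (Or.inr rfl))
  have hT2 : S \ {b} = T := by
    rw [← hTS, Set.union_sdiff_right, Set.sdiff_singleton_eq_self hb.2]
  exact ⟨b, hb.1, hT2 ▸ hT.prop.2.2, a, hT2 ▸ ha, hab⟩

theorem ConnSet.tripod [Finite V] {K : Set V} (hK : ConnSet G K) {N : Set V} {a b c : V}
    (ha : a ∈ K) (hb : b ∈ K) (hc : c ∈ K) (hab : a ≠ b) (hac : a ≠ c) (hbc : b ≠ c)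
    (hN : a ∈ N ∧ b ∈ N ∧ c ∈ N) :
    ∃ T A B, K = T ∪ A ∪ B ∧ Disjoint T A ∧ Disjoint T B ∧ Disjoint A B ∧ ConnSet G T ∧
      ConnSet G A ∧ ConnSet G B ∧ Touch G T A ∧ Touch G T B ∧
      (∃ x ∈ T, x ∈ N) ∧ (∃ x ∈ A, x ∈ N) ∧ (∃ x ∈ B, x ∈ N) := by
  have key : ∀ {X Y : Set V} {a b c : V}, ConnSet G X → ConnSet G Y → Disjoint X Y →
      Touch G X Y → a ∈ X → b ∈ Y → c ∈ Y → b ≠ c → a ∈ N → b ∈ N → c ∈ N →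
      ∃ T A B, X ∪ Y = T ∪ A ∪ B ∧ Disjoint T A ∧ Disjoint T B ∧ Disjoint A B ∧ ConnSet G T ∧
      ConnSet G A ∧ ConnSet G B ∧ Touch G T A ∧ Touch G T B ∧
      (∃ x ∈ T, x ∈ N) ∧ (∃ x ∈ A, x ∈ N) ∧ (∃ x ∈ B, x ∈ N) := by
    intro X Y a b c hX hY hd ht ha hb hc hbc haN hbN hcN
    obtain ⟨P, Q, rfl, hPQ, hbP, hcQ, hP, hQ, htPQ⟩ := hY.split hb hc hbc
    rw [Set.disjoint_union_right] at hd
    rw [touch_union_right] at ht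
    rcases ht with ht | ht
    · exact ⟨P, Q, X, by grind, hPQ, hd.1.symm, hd.2.symm, hP, hQ, hX, htPQ, ht.symm,
        ⟨b, hbP, hbN⟩, ⟨c, hcQ, hcN⟩, ⟨a, ha, haN⟩⟩
    · exact ⟨Q, P, X, by grind, hPQ.symm, hd.2.symm, hd.1.symm, hQ, hP, hX, htPQ.symm, ht.symm,
        ⟨c, hcQ, hcN⟩, ⟨b, hbP, hbN⟩, ⟨a, ha, haN⟩⟩
  obtain ⟨X, Y, rfl, hXY, haX, hbY, hX, hY, ht⟩ := hK.split ha hb hab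
  rcases hc with hc | hc
  · have := key hY hX hXY.symm ht.symm hbY haX hc hac hN.2.1 hN.1 hN.2.2
    rwa [Set.union_comm] at this
  · exact key hX hY hXY ht haX hbY hc hbc hN.1 hN.2.1 hN.2.2

/-- `A`, `B`, `C` form a model of a triangle. -/
def Tri (G : SimpleGraph V) (A B C : Set V) : Prop :=
  (ConnSet G A ∧ ConnSet G B ∧ ConnSet G C) ∧ (Disjoint A B ∧ Disjoint A C ∧ Disjoint B C) ∧
    Touch G A B ∧ Touch G A C ∧ Touch G B C

theorem Tri.rotate {A B C : Set V} (h : Tri G A B C) : Tri G B C A :=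
  ⟨⟨h.1.2.1, h.1.2.2, h.1.1⟩, ⟨h.2.1.2.2, h.2.1.1.symm, h.2.1.2.1.symm⟩,
    h.2.2.2.2, h.2.2.1.symm, h.2.2.2.1.symm⟩

theorem Tri.swap {A B C : Set V} (h : Tri G A B C) : Tri G B A C :=
  ⟨⟨h.1.2.1, h.1.1, h.1.2.2⟩, ⟨h.2.1.1.symm, h.2.1.2.2, h.2.1.2.1⟩,
    h.2.2.1.symm, h.2.2.2.2, h.2.2.2.1⟩

theorem Tri.conn {A B C : Set V} (h : Tri G A B C) : ConnSet G (A ∪ B ∪ C) :=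
  (h.1.1.union_touch h.1.2.1 h.2.2.1).union_touch h.1.2.2
    (h.2.2.2.1.mono Set.subset_union_left subset_rfl)

/-- `S` contains a model of a triangle, i.e. `G[S]` has a cycle. -/
def Cyc (G : SimpleGraph V) (S : Set V) : Prop := ∃ A B C, A ∪ B ∪ C ⊆ S ∧ Tri G A B C

theorem Cyc.mono {S T : Set V} (h : Cyc G S) (hST : S ⊆ T) : Cyc G T := by
  obtain ⟨A, B, C, hS, ht⟩ := h
  exact ⟨A, B, C, hS.trans hST, ht⟩

theorem Tri.grow {A B C : Set V} (h : Tri G A B C) {x y : V} (hy : y ∈ A) (hxy : G.Adj y x)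
    (hx : x ∉ A ∪ B ∪ C) : Tri G (A ∪ {x}) B C := by
  simp only [Set.mem_union, not_or] at hx
  refine ⟨⟨h.1.1.union_singleton hy hxy, h.1.2⟩, ⟨?_, ?_, h.2.1.2.2⟩,
    h.2.2.1.mono Set.subset_union_left subset_rfl,
    h.2.2.2.1.mono Set.subset_union_left subset_rfl, h.2.2.2.2⟩
  · rw [Set.disjoint_union_left]; exact ⟨h.2.1.1, by simpa using hx.1.2⟩
  · rw [Set.disjoint_union_left]; exact ⟨h.2.1.2.1, by simpa using hx.2⟩

/-- In a connected set with a cycle, a triangle model may be chosen spanning. -/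
theorem Cyc.spanning [Finite V] {S : Set V} (hc : Cyc G S) (hS : ConnSet G S) :
    ∃ A B C, S = A ∪ B ∪ C ∧ Tri G A B C := by
  obtain ⟨A₀, B₀, C₀, hsub, ht⟩ := hc
  obtain ⟨U, -, hU⟩ := Set.Finite.exists_le_maximal
    (Set.toFinite {U : Set V | U ⊆ S ∧ ∃ A B C, U = A ∪ B ∪ C ∧ Tri G A B C})
    ⟨hsub, A₀, B₀, C₀, rfl, ht⟩
  obtain ⟨hUS, A, B, C, rfl, ht⟩ := hU.prop
  refine ⟨A, B, C, ?_, ht⟩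
  by_contra hne
  have hne' : (S \ (A ∪ B ∪ C)).Nonempty := by
    rw [Set.sdiff_nonempty]
    exact fun h => hne (h.antisymm hUS)
  obtain ⟨y, hy, x, hx, hyx⟩ := hS.touch_diff hUS ht.conn.1 hne'
  have key : ∀ A' B' C', A' ∪ B' ∪ C' = A ∪ B ∪ C → Tri G A' B' C' → y ∈ A' → False := by
    intro A' B' C' he ht' hy'
    have hx' : x ∉ A' ∪ B' ∪ C' := he ▸ hx.2
    have := hU.le_of_ge (y := A' ∪ {x} ∪ B' ∪ C') ⟨?_, _, _, _, rfl, ht'.grow hy' hyx hx'⟩ ?_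
    · exact hx.2 (this (by simp))
    · have := hx.1
      grind
    · change A ∪ B ∪ C ⊆ _
      rw [← he]; grind
  rcases hy with (hy | hy) | hy
  · exact key A B C rfl ht hy
  · exact key B A C (by grind) ht.swap hy
  · exact key C A B (by grind) ht.rotate.rotate hy

theorem Cyc.spanning_at [Finite V] {S : Set V} (hc : Cyc G S) (hS : ConnSet G S) {a : V}
    (ha : a ∈ S) : ∃ A B C, S = A ∪ B ∪ C ∧ Tri G A B C ∧ a ∈ A := by
  obtain ⟨A, B, C, rfl, ht⟩ := hc.spanning hS
  rcases ha with (ha | ha) | ha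
  · exact ⟨A, B, C, rfl, ht, ha⟩
  · exact ⟨B, A, C, by grind, ht.swap, ha⟩
  · exact ⟨C, A, B, by grind, ht.rotate.rotate, ha⟩

/-- Position of two vertices with respect to a spanning triangle model: they are separated by
the triangle, or one of them lies in a branch hanging off the part containing the other. -/
theorem Cyc.separate [Finite V] {K : Set V} (hc : Cyc G K) (hK : ConnSet G K) {a b : V}
    (ha : a ∈ K) (hb : b ∈ K) (hab : a ≠ b) :
    (∃ A B C, K = A ∪ B ∪ C ∧ Tri G A B C ∧ a ∈ A ∧ b ∈ B) ∨
    ∃ X X' B C, K = X ∪ X' ∪ B ∪ C ∧ Tri G X B C ∧ ConnSet G X' ∧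
      (Disjoint X X' ∧ Disjoint X' B ∧ Disjoint X' C) ∧ Touch G X X' ∧
      (a ∈ X ∧ b ∈ X' ∨ b ∈ X ∧ a ∈ X') := by
  obtain ⟨A, B, C, rfl, ht, haA⟩ := hc.spanning_at hK ha
  rcases hb with (hb | hb) | hb
  · obtain ⟨hcn, hd, htc⟩ := ht
    obtain ⟨P, Q, rfl, hPQ, haP, hbQ, hP, hQ, hpq⟩ := hcn.1.split haA hb hab
    simp only [Set.disjoint_union_left, touch_union_left] at hd htc
    have mk : ∀ P Q, ConnSet G P → Disjoint P B → Disjoint P C → Touch G P B → Touch G P C →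
        ConnSet G Q → Disjoint Q B → Disjoint Q C → Disjoint P Q → Touch G P Q →
        (a ∈ P ∧ b ∈ Q ∨ b ∈ P ∧ a ∈ Q) → ∃ X X' B' C', P ∪ Q ∪ B ∪ C = X ∪ X' ∪ B' ∪ C' ∧
          Tri G X B' C' ∧ ConnSet G X' ∧ (Disjoint X X' ∧ Disjoint X' B' ∧ Disjoint X' C') ∧
          Touch G X X' ∧ (a ∈ X ∧ b ∈ X' ∨ b ∈ X ∧ a ∈ X') :=
      fun P Q h1 h2 h3 h4 h5 h6 h7 h8 h9 h10 h11 => ⟨P, Q, B, C, rfl,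
        ⟨⟨h1, hcn.2⟩, ⟨h2, h3, hd.2.2⟩, h4, h5, htc.2.2⟩, h6, ⟨h9, h7, h8⟩, h10, h11⟩
    obtain ⟨⟨hPB, hQB⟩, ⟨hPC, hQC⟩, hBC⟩ := hd
    obtain ⟨tB | tB, tC | tC, tBC⟩ := htc
    · exact Or.inr (mk P Q hP hPB hPC tB tC hQ hQB hQC hPQ hpq (Or.inl ⟨haP, hbQ⟩))
    · refine Or.inl ⟨P, Q ∪ C, B, by grind, ⟨⟨hP, hQ.union_touch hcn.2.2 tC, hcn.2.1⟩,
        ⟨?_, hPB, ?_⟩, ?_, tB, ?_⟩, haP, Or.inl hbQ⟩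
      · exact Set.disjoint_union_right.2 ⟨hPQ, hPC⟩
      · exact Set.disjoint_union_left.2 ⟨hQB, hBC.symm⟩
      · exact touch_union_right.2 (Or.inl hpq)
      · exact touch_union_left.2 (Or.inr tBC.symm)
    · refine Or.inl ⟨P, Q ∪ B, C, by grind, ⟨⟨hP, hQ.union_touch hcn.2.1 tB, hcn.2.2⟩,
        ⟨?_, hPC, ?_⟩, ?_, tC, ?_⟩, haP, Or.inl hbQ⟩
      · exact Set.disjoint_union_right.2 ⟨hPQ, hPB⟩
      · exact Set.disjoint_union_left.2 ⟨hQC, hBC⟩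
      · exact touch_union_right.2 (Or.inl hpq)
      · exact touch_union_left.2 (Or.inr tBC)
    · rw [Set.union_comm P Q]
      exact Or.inr (mk Q P hQ hQB hQC tB tC hP hPB hPC hPQ.symm hpq.symm (Or.inr ⟨hbQ, haP⟩))
  · exact Or.inl ⟨A, B, C, rfl, ht, haA, hb⟩
  · exact Or.inl ⟨A, C, B, by grind, ht.rotate.swap.rotate.rotate, haA, hb⟩

/-- A model of the diamond; `A` and `B` are the branch sets of degree three. -/
def Diamond (G : SimpleGraph V) (A B C E : Set V) : Prop :=
  (ConnSet G A ∧ ConnSet G B ∧ ConnSet G C ∧ ConnSet G E) ∧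
    (Disjoint A B ∧ Disjoint A C ∧ Disjoint A E ∧ Disjoint B C ∧ Disjoint B E ∧ Disjoint C E) ∧
    Touch G A B ∧ Touch G A C ∧ Touch G A E ∧ Touch G B C ∧ Touch G B E

/-- A model of the butterfly, with central branch set `X`. -/
def Butterfly (G : SimpleGraph V) (X A B A' B' : Set V) : Prop :=
  Tri G X A B ∧ Tri G X A' B' ∧ Disjoint A A' ∧ Disjoint A B' ∧ Disjoint B A' ∧ Disjoint B B'

/-- `S` contains a model of the diamond or of the butterfly. -/
def DB (G : SimpleGraph V) (S : Set V) : Prop :=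
  (∃ A B C E, A ∪ B ∪ C ∪ E ⊆ S ∧ Diamond G A B C E) ∨
  ∃ X A B A' B', X ∪ A ∪ B ∪ A' ∪ B' ⊆ S ∧ Butterfly G X A B A' B'

theorem DB.mono {S T : Set V} (h : DB G S) (hST : S ⊆ T) : DB G T := by
  rcases h with ⟨A, B, C, E, hS, h⟩ | ⟨X, A, B, A', B', hS, h⟩
  · exact Or.inl ⟨A, B, C, E, hS.trans hST, h⟩
  · exact Or.inr ⟨X, A, B, A', B', hS.trans hST, h⟩

/-- A connected set with a cycle, together with a disjoint connected set attached at two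
vertices, contains a diamond or a butterfly. -/
theorem Cyc.db_union [Finite V] {K Y : Set V} (hc : Cyc G K) (hK : ConnSet G K)
    (hY : ConnSet G Y) (hd : Disjoint K Y) {a b : V} (ha : a ∈ K) (hb : b ∈ K) (hab : a ≠ b)
    (hay : Touch G {a} Y) (hby : Touch G {b} Y) : DB G (K ∪ Y) := by
  have mem : ∀ {c : V} {S : Set V}, c ∈ S → Touch G {c} Y → Touch G S Y := fun hc ht =>
    ht.mono (by simpa using hc) subset_rfl
  rcases hc.separate hK ha hb hab with ⟨A, B, C, rfl, ht, haA, hbB⟩ |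
    ⟨X, X', B, C, rfl, ht, hX', hd', htX, h⟩
  · left
    simp only [Set.disjoint_union_left] at hd
    exact ⟨A, B, C, Y, subset_rfl, ⟨ht.1.1, ht.1.2.1, ht.1.2.2, hY⟩,
      ⟨ht.2.1.1, ht.2.1.2.1, hd.1.1, ht.2.1.2.2, hd.1.2, hd.2⟩,
      ht.2.2.1, ht.2.2.2.1, mem haA hay, ht.2.2.2.2, mem hbB hby⟩
  · right
    simp only [Set.disjoint_union_left] at hd
    have hXY : Touch G X Y ∧ Touch G X' Y := by
      rcases h with h | h
      · exact ⟨mem h.1 hay, mem h.2 hby⟩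
      · exact ⟨mem h.1 hby, mem h.2 hay⟩
    exact ⟨X, B, C, X', Y, by grind, ht, ⟨⟨ht.1.1, hX', hY⟩, ⟨hd'.1, hd.1.1.1, hd.1.1.2⟩,
      htX, hXY.1, hXY.2⟩, hd'.2.1.symm, hd.1.2, hd'.2.2.symm, hd.2⟩

/-- Ordered pairs of adjacent vertices with first entry in `X` and second entry in `Y`. -/
def crossing (G : SimpleGraph V) (X Y : Set V) : Set (V × V) :=
  {p | p.1 ∈ X ∧ p.2 ∈ Y ∧ G.Adj p.1 p.2}

/-- Twice the cycle rank of `G[S]`, for `S` connected. -/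
noncomputable def rk (G : SimpleGraph V) (S : Set V) : ℤ :=
  (crossing G S S).ncard - 2 * S.ncard + 2

theorem crossing_ncard_comm (X Y : Set V) : (crossing G X Y).ncard = (crossing G Y X).ncard := by
  rw [← Set.ncard_image_of_injective _ Prod.swap_injective]
  congr 1
  ext ⟨a, b⟩
  simp only [crossing, Set.mem_image, Set.mem_ofPred_eq, Prod.exists, Prod.swap_prod_mk,
    Prod.mk.injEq]
  constructor
  · rintro ⟨c, d, ⟨h1, h2, h3⟩, rfl, rfl⟩
    exact ⟨h2, h1, h3.symm⟩
  · rintro ⟨h1, h2, h3⟩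
    exact ⟨b, a, ⟨h2, h1, h3.symm⟩, rfl, rfl⟩

theorem crossing_ncard_union_left [Finite V] {X X' Y : Set V} (h : Disjoint X X') :
    (crossing G (X ∪ X') Y).ncard = (crossing G X Y).ncard + (crossing G X' Y).ncard := by
  rw [← Set.ncard_union_eq _ (Set.toFinite _) (Set.toFinite _)]
  · congr 1
    ext p
    simp only [crossing, Set.mem_union, Set.mem_ofPred_eq]
    tauto
  · rw [Set.disjoint_left] at h ⊢
    exact fun p hp hp' => h hp.1 hp'.1

theorem crossing_ncard_union_right [Finite V] {X X' Y : Set V} (h : Disjoint X X') :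
    (crossing G Y (X ∪ X')).ncard = (crossing G Y X).ncard + (crossing G Y X').ncard := by
  rw [crossing_ncard_comm, crossing_ncard_union_left h, crossing_ncard_comm X,
    crossing_ncard_comm X']

theorem rk_union [Finite V] {X Y : Set V} (h : Disjoint X Y) :
    rk G (X ∪ Y) = rk G X + rk G Y + 2 * (crossing G X Y).ncard - 2 := by
  rw [rk, rk, rk, crossing_ncard_union_left h, crossing_ncard_union_right h,
    crossing_ncard_union_right h, crossing_ncard_comm Y X, Set.ncard_union_eq h]
  push_cast
  ring

theorem rk_singleton (x : V) : rk G {x} = 0 := by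
  have : crossing G {x} {x} = ∅ := by
    ext ⟨a, b⟩
    simp only [crossing, Set.mem_singleton_iff, Set.mem_ofPred_eq, Set.mem_empty_iff_false,
      iff_false]
    rintro ⟨rfl, rfl, h⟩
    exact h.ne rfl
  simp [rk, this]

theorem exists_two_of_crossing [Finite V] {X Y : Set V} (h : 2 ≤ (crossing G X Y).ncard) :
    ∃ a ∈ X, ∃ b ∈ Y, ∃ a' ∈ X, ∃ b' ∈ Y, G.Adj a b ∧ G.Adj a' b' ∧ (a ≠ a' ∨ b ≠ b') := by
  obtain ⟨p, q, hp, hq, hpq⟩ := (Set.one_lt_ncard_iff (Set.toFinite _)).1 h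
  refine ⟨p.1, hp.1, p.2, hp.2.1, q.1, hq.1, q.2, hq.2.1, hp.2.2, hq.2.2, ?_⟩
  by_contra hcon
  push Not at hcon
  exact hpq (Prod.ext hcon.1 hcon.2)

theorem exists_three_of_crossing [Finite V] {X Y : Set V} (h : 3 ≤ (crossing G X Y).ncard) :
    ∃ p q r, p ∈ crossing G X Y ∧ q ∈ crossing G X Y ∧ r ∈ crossing G X Y ∧
      p ≠ q ∧ p ≠ r ∧ q ≠ r :=
  (Set.two_lt_ncard_iff (Set.toFinite _)).1 h

theorem one_le_crossing [Finite V] {X Y : Set V} (h : Touch G X Y) :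
    1 ≤ (crossing G X Y).ncard := by
  obtain ⟨a, ha, b, hb, hab⟩ := h
  exact Nat.one_le_iff_ne_zero.2 (Set.ncard_ne_zero_of_mem (a := (a, b)) ⟨ha, hb, hab⟩)

/-- Induction over connected sets by removal of a non-cut vertex. -/
theorem ConnSet.induct [Finite V] {P : Set V → Prop} (h1 : ∀ x, P {x})
    (h2 : ∀ K y, ConnSet G K → y ∉ K → Touch G K {y} → P K → P (K ∪ {y}))
    {S : Set V} (hS : ConnSet G S) : P S := by
  induction hn : S.ncard using Nat.strong_induction_on generalizing S with
  | _ n ih =>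
    subst hn
    rcases S.subsingleton_or_nontrivial with h | h
    · obtain ⟨x, hx⟩ := hS.1
      rw [h.eq_singleton_of_mem hx]
      exact h1 x
    · obtain ⟨y, hy, hK, z, hz, hzy⟩ := hS.exists_noncut h
      have := h2 (S \ {y}) y hK (by simp) ⟨z, hz, y, rfl, hzy⟩
        (ih _ (Set.ncard_sdiff_singleton_lt_of_mem hy) hK rfl)
      rwa [Set.sdiff_union_of_subset (by simpa using hy)] at this

theorem rk_add_singleton [Finite V] {K : Set V} {y : V} (hy : y ∉ K) :
    rk G (K ∪ {y}) = rk G K + 2 * (crossing G K {y}).ncard - 2 := by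
  rw [rk_union (by simpa using hy), rk_singleton]
  ring

theorem ConnSet.rk_nonneg [Finite V] {S : Set V} (hS : ConnSet G S) : 0 ≤ rk G S := by
  refine hS.induct (P := fun S => 0 ≤ rk G S) (fun x => (rk_singleton x).ge) ?_
  intro K y _ hy ht ih
  rw [rk_add_singleton hy]
  have := one_le_crossing ht
  omega

theorem rk_even (S : Set V) [Finite V] (hS : ConnSet G S) : Even (rk G S) := by
  refine hS.induct (P := fun S => Even (rk G S)) (fun x => by simp [rk_singleton]) ?_
  intro K y _ hy _ ih
  rw [rk_add_singleton hy]
  grind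

theorem ConnSet.rk_mono [Finite V] {S W : Set V} (hS : ConnSet G S) (hW : ConnSet G W)
    (hSW : S ⊆ W) : rk G S ≤ rk G W := by
  obtain ⟨T, hST, hT⟩ := Set.Finite.exists_le_maximal
    (Set.toFinite {T : Set V | T ⊆ W ∧ ConnSet G T ∧ rk G S ≤ rk G T}) ⟨hSW, hS, le_rfl⟩
  by_cases h : T = W
  · exact h ▸ hT.prop.2.2
  have hne : (W \ T).Nonempty := by
    rw [Set.sdiff_nonempty]
    exact fun h' => h (hT.prop.1.antisymm h')
  obtain ⟨a, ha, b, hb, hab⟩ := hW.touch_diff hT.prop.1 hT.prop.2.1.1 hne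
  refine absurd (hT.le_of_ge (y := T ∪ {b}) ⟨Set.union_subset hT.prop.1 (by simpa using hb.1),
    hT.prop.2.1.union_singleton ha hab, ?_⟩ Set.subset_union_left (Or.inr rfl)) hb.2
  rw [rk_add_singleton hb.2]
  have := one_le_crossing (G := G) (X := T) (Y := {b}) ⟨a, ha, b, rfl, hab⟩
  have := hT.prop.2.2
  omega

theorem exists_two_neighbors [Finite V] {K : Set V} {y : V} (h : 2 ≤ (crossing G K {y}).ncard) :
    ∃ a ∈ K, ∃ b ∈ K, a ≠ b ∧ G.Adj a y ∧ G.Adj b y := by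
  obtain ⟨a, ha, b, rfl, a', ha', b', rfl, h1, h2, h3⟩ := exists_two_of_crossing h
  exact ⟨a, ha, a', ha', by simpa using h3, h1, h2⟩

/-- An acyclic connected set has rank zero. -/
theorem ConnSet.rk_le_zero [Finite V] {S : Set V} (hS : ConnSet G S) (hc : ¬ Cyc G S) :
    rk G S ≤ 0 := by
  refine hS.induct (P := fun S => ¬ Cyc G S → rk G S ≤ 0) (fun x _ => (rk_singleton x).le) ?_ hc
  intro K y hK hy ht ih hc
  rw [rk_add_singleton hy]
  have := ih fun h => hc (h.mono Set.subset_union_left)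
  have : (crossing G K {y}).ncard < 2 := by
    by_contra hcon
    obtain ⟨a, ha, b, hb, hab, hay, hby⟩ := exists_two_neighbors (not_lt.1 hcon)
    obtain ⟨A, B, rfl, hd, haA, hbB, hA, hB, hAB⟩ := hK.split ha hb hab
    simp only [Set.mem_union, not_or] at hy
    exact hc ⟨A, B, {y}, subset_rfl, ⟨hA, hB, connSet_singleton y⟩,
      ⟨hd, by simpa using hy.1, by simpa using hy.2⟩, hAB, ⟨a, haA, y, rfl, hay⟩,
      ⟨b, hbB, y, rfl, hby⟩⟩
  omega

/-- A connected set without diamond and butterfly has at most one cycle. -/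
theorem ConnSet.rk_le_two [Finite V] {S : Set V} (hS : ConnSet G S) (hc : ¬ DB G S) :
    rk G S ≤ 2 := by
  refine hS.induct (P := fun S => ¬ DB G S → rk G S ≤ 2)
    (fun x _ => by rw [rk_singleton]; norm_num) ?_ hc
  intro K y hK hy ht ih hc
  rw [rk_add_singleton hy]
  have h1 := ih fun h => hc (h.mono Set.subset_union_left)
  by_cases h2 : (crossing G K {y}).ncard < 2
  · omega
  have h3 : ¬ Cyc G K := by
    intro hcyc
    obtain ⟨a, ha, b, hb, hab, hay, hby⟩ := exists_two_neighbors (not_lt.1 h2)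
    exact hc (hcyc.db_union hK (connSet_singleton y) (by simpa using hy) ha hb hab
      ⟨a, rfl, y, rfl, hay⟩ ⟨b, rfl, y, rfl, hby⟩)
  have h4 := hK.rk_le_zero h3
  by_cases h5 : (crossing G K {y}).ncard < 3
  · omega
  obtain ⟨p, q, r, ⟨hp1, hp2, hp⟩, ⟨hq1, hq2, hq⟩, ⟨hr1, hr2, hr⟩, hpq, hpr, hqr⟩ :=
    exists_three_of_crossing (not_lt.1 h5)
  have ne : ∀ {p q : V × V}, p.2 ∈ ({y} : Set V) → q.2 ∈ ({y} : Set V) → p ≠ q → p.1 ≠ q.1 :=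
    fun h h' hne h'' => hne (Prod.ext h'' (h.trans h'.symm))
  obtain ⟨T, A, B, rfl, h12, h13, h23, hT, hA, hB, hTA, hTB, ⟨t, htT, ht'⟩, ⟨a, haA, ha'⟩,
    b, hbB, hb'⟩ := hK.tripod (N := {z | G.Adj z y}) hp1 hq1 hr1 (ne hp2 hq2 hpq) (ne hp2 hr2 hpr)
      (ne hq2 hr2 hqr) ⟨hp2 ▸ hp, hq2 ▸ hq, hr2 ▸ hr⟩
  simp only [Set.mem_union, not_or] at hy
  exact absurd (Or.inl ⟨T, {y}, A, B, by grind, ⟨hT, connSet_singleton y, hA, hB⟩,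
    ⟨by simpa using hy.1.1, h12, h13, by simpa using hy.1.2, by simpa using hy.2, h23⟩,
    ⟨t, htT, y, rfl, ht'⟩, hTA, hTB, ⟨y, rfl, a, haA, ha'.symm⟩, ⟨y, rfl, b, hbB, hb'.symm⟩⟩) hc

theorem ConnSet.reachable {S : Set V} (hS : ConnSet G S) {a b : V} (ha : a ∈ S) (hb : b ∈ S) :
    G.Reachable a b := by
  simpa using ((connSet_iff.1 hS).preconnected ⟨a, ha⟩ ⟨b, hb⟩).map
    (SimpleGraph.Embedding.induce S).toHom

theorem ConnSet.mono_graph {G' : SimpleGraph V} {S : Set V} (hS : ConnSet G S)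
    (h : ∀ a ∈ S, ∀ b ∈ S, G.Adj a b → G'.Adj a b) : ConnSet G' S :=
  ⟨hS.1, fun T hT hne hcl => hS.2 T hT hne fun a ha b hb hab =>
    hcl a ha b hb (h a (hT ha) b hb hab)⟩

theorem rk_deleteEdge [Finite V] {S : Set V} {x y : V} (hx : x ∈ S) (hy : y ∈ S)
    (h : G.Adj x y) : rk (G.deleteEdges {s(x, y)}) S = rk G S - 2 := by
  have h1 : crossing G S S = crossing (G.deleteEdges {s(x, y)}) S S ∪ {(x, y), (y, x)} := by
    ext ⟨a, b⟩
    simp only [crossing, Set.mem_union, Set.mem_ofPred_eq, deleteEdges_adj, Set.mem_insert_iff,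
      Set.mem_singleton_iff, Prod.mk.injEq, Sym2.eq_iff]
    constructor
    · tauto
    · rintro (h' | ⟨rfl, rfl⟩ | ⟨rfl, rfl⟩)
      · tauto
      · exact ⟨hx, hy, h⟩
      · exact ⟨hy, hx, h.symm⟩
  have h2 : Disjoint (crossing (G.deleteEdges {s(x, y)}) S S) {(x, y), (y, x)} := by
    rw [Set.disjoint_left]
    rintro ⟨a, b⟩ ⟨-, -, hab⟩ hm
    simp only [deleteEdges_adj, Set.mem_singleton_iff, Sym2.eq_iff] at hab
    simp only [Set.mem_insert_iff, Set.mem_singleton_iff, Prod.mk.injEq] at hm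
    tauto
  have h3 : ({(x, y), (y, x)} : Set (V × V)).ncard = 2 :=
    Set.ncard_pair fun h' => h.ne (Prod.mk.inj h').1
  rw [rk, rk, h1, Set.ncard_union_eq h2, h3]
  push_cast
  ring

/-- A connected set of positive rank has an edge which is not a bridge. -/
theorem ConnSet.exists_nonbridge [Finite V] {S : Set V} (hS : ConnSet G S) (h : 0 < rk G S) :
    ∃ x ∈ S, ∃ y ∈ S, G.Adj x y ∧ ConnSet (G.deleteEdges {s(x, y)}) S := by
  refine hS.induct (P := fun S => 0 < rk G S → ∃ x ∈ S, ∃ y ∈ S, G.Adj x y ∧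
    ConnSet (G.deleteEdges {s(x, y)}) S) (fun x h => by simp [rk_singleton] at h) ?_ h
  intro K y hK hy ht ih h
  rw [rk_add_singleton hy] at h
  by_cases h2 : 2 ≤ (crossing G K {y}).ncard
  · obtain ⟨a, ha, b, hb, hab, hay, hby⟩ := exists_two_neighbors h2
    refine ⟨a, Or.inl ha, y, Or.inr rfl, hay, ConnSet.union_singleton (y := b) ?_ hb ?_⟩
    · refine hK.mono_graph fun u hu v hv huv => ?_
      simp only [deleteEdges_adj, Set.mem_singleton_iff, Sym2.eq_iff]
      grind
    · simp only [deleteEdges_adj, Set.mem_singleton_iff, Sym2.eq_iff]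
      grind
  · obtain ⟨u, hu, v, hv, huv, hc⟩ := ih (by omega)
    obtain ⟨a, ha, b, rfl, hab⟩ := ht
    refine ⟨u, Or.inl hu, v, Or.inl hv, huv, hc.union_singleton ha ?_⟩
    simp only [deleteEdges_adj, Set.mem_singleton_iff, Sym2.eq_iff]
    grind

theorem Pseudoforest.rk_le [Finite V] (h : Pseudoforest G) {S : Set V} (hS : ConnSet G S) :
    rk G S ≤ 2 := by
  classical
  by_contra hcon
  obtain ⟨x, hx, y, hy, hxy, hc⟩ := hS.exists_nonbridge (by omega)
  obtain ⟨x', hx', y', hy', hxy', hc'⟩ := hc.exists_nonbridge (by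
    rw [rk_deleteEdge hx hy hxy]; omega)
  obtain ⟨u, c, hcc, hce⟩ := adj_and_reachable_delete_edges_iff_exists_cycle.1
    ⟨hxy, hc.reachable hx hy⟩
  obtain ⟨u', c', hcc', hce'⟩ := adj_and_reachable_delete_edges_iff_exists_cycle.1
    ⟨hxy', hc'.reachable hx' hy'⟩
  have hle : G.deleteEdges {s(x, y)} ≤ G := deleteEdges_le _
  have hr : G.Reachable u u' := by
    have h1 : G.Reachable u x := ⟨c.takeUntil x (Walk.fst_mem_support_of_mem_edges _ hce)⟩
    have h2 : G.Reachable u' x' :=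
      ⟨(c'.takeUntil x' (Walk.fst_mem_support_of_mem_edges _ hce')).mapLe hle⟩
    exact h1.trans ((hS.reachable hx hx').trans h2.symm)
  have := (h c (c'.mapLe hle) hcc (hcc'.mapLe hle) hr s(x, y)).1 hce
  rw [Walk.edges_mapLe_eq_edges] at this
  have := c'.edges_subset_edgeSet this
  simp at this

theorem ConnSet.deleteEdge_of_cycle {S : Set V} (hS : ConnSet G S)
    (hcl : ∀ a ∈ S, ∀ b, G.Adj a b → b ∈ S) {u : V} {c : G.Walk u u} (hc : c.IsCycle) {x y : V}
    (he : s(x, y) ∈ c.edges) : ConnSet (G.deleteEdges {s(x, y)}) S := by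
  have hr := (adj_and_reachable_delete_edges_iff_exists_cycle.2 ⟨u, c, hc, he⟩).2
  refine ⟨hS.1, fun T hT hne hclT => hS.2 T hT hne fun a ha b hb hab => ?_⟩
  have key : ∀ a b, (G.deleteEdges {s(x, y)}).Walk a b → a ∈ T → b ∈ T := by
    intro a b w
    induction w with
    | nil => exact id
    | cons hadj _ ih =>
      exact fun ha => ih (hclT _ ha _ (hcl _ (hT ha) _ (deleteEdges_adj.1 hadj).1) hadj)
  by_cases h : s(a, b) = s(x, y)
  · rw [Sym2.eq_iff] at h
    obtain ⟨w⟩ := hr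
    rcases h with ⟨rfl, rfl⟩ | ⟨rfl, rfl⟩
    · exact key _ _ w ha
    · exact key _ _ w.reverse ha
  · exact hclT a ha b hb (deleteEdges_adj.2 ⟨hab, by simpa using h⟩)

theorem pseudoforest_of_rk_le [Finite V] (h : ∀ S, ConnSet G S → rk G S ≤ 2) :
    Pseudoforest G := by
  classical
  have key : ∀ (u v : V) (c : G.Walk u u) (c' : G.Walk v v), c.IsCycle → c'.IsCycle →
      G.Reachable u v → ∀ e, e ∈ c.edges → e ∈ c'.edges := by
    intro u v c c' hc hc' huv e he
    by_contra hcon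
    obtain ⟨x, y⟩ := e
    change s(x, y) ∈ _ at he
    change ¬ s(x, y) ∈ _ at hcon
    obtain ⟨S, huS, -, hS, hcl⟩ := (connSet_singleton (G := G) u).exists_comp
      (Set.subset_univ _)
    have hclr : ∀ a b, G.Walk a b → a ∈ S → b ∈ S := by
      intro a b w
      induction w with
      | nil => exact id
      | cons hadj _ ih => exact fun ha => ih (hcl _ ha _ trivial hadj)
    have hvS : v ∈ S := by
      obtain ⟨w⟩ := huv
      exact hclr _ _ w (huS rfl)
    have mem : ∀ {w : V} (p : G.Walk w w) {z : V}, w ∈ S → z ∈ p.support → z ∈ S :=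
      fun p z hw hz => hclr _ _ (p.takeUntil z hz) hw
    have hS1 := hS.deleteEdge_of_cycle (fun a ha b hab => hcl a ha b trivial hab) hc he
    have hr1 := rk_deleteEdge (mem c (huS rfl) (Walk.fst_mem_support_of_mem_edges _ he))
      (mem c (huS rfl) (Walk.snd_mem_support_of_mem_edges _ he)) (c.edges_subset_edgeSet he)
    have hne : ∀ e ∈ c'.edges, e ∉ ({s(x, y)} : Set (Sym2 V)) := by
      rintro e he' rfl
      exact hcon he'
    set d := c'.toDeleteEdges {s(x, y)} hne with hd
    have hdc : d.IsCycle := Walk.IsCycle.toDeleteEdges _ {s(x, y)} hc' hne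
    obtain ⟨e', he'⟩ : ∃ e', e' ∈ d.edges := by
      apply List.exists_mem_of_ne_nil
      intro h0
      exact hdc.not_nil (Walk.edges_eq_nil.1 h0)
    obtain ⟨x', y'⟩ := e'
    change s(x', y') ∈ _ at he'
    have he2 : s(x', y') ∈ c'.edges := by
      rw [hd, Walk.toDeleteEdges, Walk.edges_transfer] at he'
      exact he'
    have hS2 := hS1.deleteEdge_of_cycle
      (fun a ha b hab => hcl a ha b trivial (deleteEdges_adj.1 hab).1) hdc he'
    have hadj : (G.deleteEdges {s(x, y)}).Adj x' y' := d.edges_subset_edgeSet he'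
    have hr2 := rk_deleteEdge (mem c' hvS (Walk.fst_mem_support_of_mem_edges _ he2))
      (mem c' hvS (Walk.snd_mem_support_of_mem_edges _ he2)) hadj
    have := hS2.rk_nonneg
    have := h S hS
    omega
  exact fun u v c c' hc hc' huv e => ⟨key u v c c' hc hc' huv e, key v u c' c hc' hc huv.symm e⟩

theorem pseudoforest_iff [Finite V] : Pseudoforest G ↔ ∀ S, ConnSet G S → rk G S ≤ 2 :=
  ⟨fun h _ => h.rk_le, pseudoforest_of_rk_le⟩

theorem connSet_image_iff {W : Type} {H : SimpleGraph W} (f : H ↪g G) {S : Set W} :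
    ConnSet G (f '' S) ↔ ConnSet H S := by
  constructor
  · rintro ⟨hne, h⟩
    refine ⟨by simpa using hne, fun T hT hTne hcl => ?_⟩
    refine f.injective.image_injective (h (f '' T) (Set.image_mono hT) (hTne.image f) ?_)
    rintro _ ⟨a, ha, rfl⟩ _ ⟨b, hb, rfl⟩ hab
    exact ⟨b, hcl a ha b hb (f.map_adj_iff.1 hab), rfl⟩
  · rintro ⟨hne, h⟩
    refine ⟨hne.image f, fun T hT hTne hcl => ?_⟩
    obtain ⟨U, hU, rfl⟩ := Set.subset_image_iff.1 hT
    rw [h U hU (by simpa using hTne) fun a ha b hb hab => ?_]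
    obtain ⟨c, hc, hcb⟩ := hcl (f a) ⟨a, ha, rfl⟩ (f b) ⟨b, hb, rfl⟩ (f.map_adj_iff.2 hab)
    exact f.injective hcb ▸ hc

theorem rk_image {W : Type} {H : SimpleGraph W} (f : H ↪g G) {S : Set W} :
    rk G (f '' S) = rk H S := by
  have : crossing G (f '' S) (f '' S) = Prod.map f f '' crossing H S S := by
    ext ⟨a, b⟩
    simp only [crossing, Set.mem_image, Set.mem_ofPred_eq, Prod.exists, Prod.map_apply,
      Prod.mk.injEq]
    constructor
    · rintro ⟨⟨a, ha, rfl⟩, ⟨b, hb, rfl⟩, hab⟩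
      exact ⟨a, b, ⟨ha, hb, f.map_adj_iff.1 hab⟩, rfl, rfl⟩
    · rintro ⟨a, b, ⟨ha, hb, hab⟩, rfl, rfl⟩
      exact ⟨⟨a, ha, rfl⟩, ⟨b, hb, rfl⟩, f.map_adj_iff.2 hab⟩
  rw [rk, rk, this, Set.ncard_image_of_injective _ (f.injective.prodMap f.injective),
    Set.ncard_image_of_injective _ f.injective]

theorem apexPseudoforest_iff [Finite V] : ApexPseudoforest G ↔
    ∃ s : Set V, s.Subsingleton ∧ ∀ S ⊆ sᶜ, ConnSet G S → rk G S ≤ 2 := by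
  refine exists_congr fun s => and_congr_right fun _ => ?_
  rw [pseudoforest_iff]
  constructor
  · intro h S hS hc
    obtain ⟨T, rfl⟩ : ∃ T : Set ↥sᶜ, S = SimpleGraph.Embedding.induce (G := G) sᶜ '' T :=
      ⟨Subtype.val ⁻¹' S, by
        change S = Subtype.val '' _
        rw [Subtype.image_preimage_coe, Set.inter_eq_right.2 hS]⟩
    rw [rk_image]
    exact h T ((connSet_image_iff _).1 hc)
  · intro h S hS
    rw [← rk_image (SimpleGraph.Embedding.induce sᶜ)]
    refine h _ ?_ ((connSet_image_iff _).2 hS)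
    rintro _ ⟨a, -, rfl⟩
    exact a.2

theorem not_apexPseudoforest_iff [Finite V] : ¬ ApexPseudoforest G ↔
    ∀ s : Set V, s.Subsingleton → ∃ S ⊆ sᶜ, ConnSet G S ∧ 4 ≤ rk G S := by
  rw [apexPseudoforest_iff]
  push Not
  refine forall_congr' fun s => imp_congr_right fun _ => exists_congr fun S =>
    and_congr_right fun _ => and_congr_right fun hS => ?_
  obtain ⟨k, hk⟩ := rk_even S hS
  omega

/-- `Grows E k l` certifies that the vertices of `l`, added from the last to the first, form a
connected set of `mkGraph n E` whose number of edges is at least its size plus `k - 1`. -/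
def Grows {n : ℕ} (E : List (ℕ × ℕ)) : ℕ → List (Fin n) → Bool
  | _, [] => false
  | k, [_] => k = 0
  | k, x :: l =>
    let c := (l.filter fun y : Fin n => ((x : ℕ), (y : ℕ)) ∈ E ∨ ((y : ℕ), (x : ℕ)) ∈ E).length
    x ∉ l ∧ 1 ≤ c ∧ Grows E (k - (c - 1)) l

theorem connSet_of_grows {n : ℕ} {E : List (ℕ × ℕ)} {k : ℕ} {l : List (Fin n)} (h : Grows E k l) :
    l.Nodup ∧ ConnSet (mkGraph n E) {x : Fin n | x ∈ l} ∧
      2 * (k : ℤ) ≤ rk (mkGraph n E) {x : Fin n | x ∈ l} := by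
  fun_induction Grows E k l with
  | case1 => simp at h
  | case2 k x =>
    have : {y | y ∈ [x]} = {x} := by simp
    simp only [decide_eq_true_eq] at h
    rw [this, rk_singleton, h]
    exact ⟨List.nodup_singleton x, connSet_singleton x, le_rfl⟩
  | case3 k x l hl c ih =>
    simp only [decide_eq_true_eq] at h
    obtain ⟨hx, hc, hg⟩ := h
    obtain ⟨hnd, hconn, hrk⟩ := ih hg
    have hset : {y | y ∈ x :: l} = {y | y ∈ l} ∪ {x} := by ext; simp
    have hadj : ∀ y ∈ l, (((x : ℕ), (y : ℕ)) ∈ E ∨ ((y : ℕ), (x : ℕ)) ∈ E) →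
        (mkGraph n E).Adj y x := by
      intro y hy h
      rw [mkGraph, fromRel_adj]
      exact ⟨fun h' => hx (h' ▸ hy), h.symm⟩
    have hcr : c ≤ (crossing (mkGraph n E) {y | y ∈ l} {x}).ncard := by
      have h1 : ((l.filter fun y : Fin n => ((x : ℕ), (y : ℕ)) ∈ E ∨ ((y : ℕ), (x : ℕ)) ∈ E).map
        fun y : Fin n => (y, x)).Nodup := (hnd.filter _).map fun a b h => (Prod.mk.inj h).1
      have h2 := Set.ncard_coe_finset ((l.filter fun y : Fin n => ((x : ℕ), (y : ℕ)) ∈ E ∨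
        ((y : ℕ), (x : ℕ)) ∈ E).map fun y : Fin n => (y, x)).toFinset
      rw [List.toFinset_card_of_nodup h1, List.length_map] at h2
      refine h2.symm.le.trans (Set.ncard_le_ncard ?_ (Set.toFinite _))
      intro p hp
      simp only [List.coe_toFinset, Set.mem_ofPred_eq, List.mem_map, List.mem_filter,
        decide_eq_true_eq] at hp
      obtain ⟨y, ⟨hy, hE⟩, rfl⟩ := hp
      exact ⟨hy, rfl, hadj y hy hE⟩
    have hpos : 0 < (crossing (mkGraph n E) {y | y ∈ l} {x}).ncard := by omega
    obtain ⟨⟨y, z⟩, hy, rfl, hyz⟩ := (Set.ncard_pos (Set.toFinite _)).1 hpos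
    refine ⟨List.nodup_cons.2 ⟨hx, hnd⟩, ?_, ?_⟩
    · rw [hset]; exact hconn.union_singleton hy hyz
    · rw [hset, rk_add_singleton (K := {y | y ∈ l}) hx]
      omega

theorem not_apexPseudoforest_of_grows {n : ℕ} {E : List (ℕ × ℕ)} (L : List (List (Fin n)))
    (h : ∀ x : Fin n, ∃ l ∈ L, x ∉ l ∧ Grows E 2 l) (h0 : ∃ l ∈ L, Grows E 2 l := by decide) :
    ¬ ApexPseudoforest (mkGraph n E) := by
  rw [not_apexPseudoforest_iff]
  intro s hs
  rcases hs.eq_empty_or_singleton with rfl | ⟨x, rfl⟩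
  · obtain ⟨l, -, hl⟩ := h0
    exact ⟨{x | x ∈ l}, by simp, (connSet_of_grows hl).2.1,
      by simpa using (connSet_of_grows hl).2.2⟩
  · obtain ⟨l, -, hx, hl⟩ := h x
    exact ⟨{x | x ∈ l}, by simpa using hx, (connSet_of_grows hl).2.1,
      by simpa using (connSet_of_grows hl).2.2⟩

theorem not_apex_O1 : ¬ ApexPseudoforest O1 :=
  not_apexPseudoforest_of_grows [[3, 2, 1, 0], [7, 6, 5, 4]] (by decide)

theorem not_apex_O2 : ¬ ApexPseudoforest O2 :=
  not_apexPseudoforest_of_grows [[4, 3, 2, 1, 0], [9, 8, 7, 6, 5]] (by decide)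

theorem not_apex_O3 : ¬ ApexPseudoforest O3 :=
  not_apexPseudoforest_of_grows [[3, 2, 1, 0], [8, 7, 6, 5, 4]] (by decide)

theorem not_apex_O4 : ¬ ApexPseudoforest O4 :=
  not_apexPseudoforest_of_grows
    [[5, 4, 3, 2], [4, 3, 2, 1, 0], [7, 6, 5, 4, 3], [7, 6, 5, 3, 2, 1, 0],
      [7, 6, 5, 4, 2, 1, 0]] (by decide)

theorem not_apex_O5 : ¬ ApexPseudoforest O5 :=
  not_apexPseudoforest_of_grows
    [[4, 3, 2, 1, 0], [7, 6, 5, 4, 3], [7, 6, 5, 3, 2, 1, 0], [5, 7, 6, 4, 2, 1, 0]] (by decide)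

theorem not_apex_O6 : ¬ ApexPseudoforest O6 :=
  not_apexPseudoforest_of_grows
    [[5, 4, 3, 2], [6, 5, 4, 3], [4, 3, 2, 1, 0], [6, 5, 3, 2, 1, 0], [7, 5, 4, 2, 1, 0]]
      (by decide)

theorem not_apex_O7 : ¬ ApexPseudoforest O7 :=
  not_apexPseudoforest_of_grows
    [[5, 4, 3, 2], [3, 2, 4, 6, 1, 0], [3, 2, 5, 6, 1, 0], [2, 5, 4, 6, 1, 0],
      [3, 5, 4, 6, 1, 0]] (by decide)

theorem not_apex_O8 : ¬ ApexPseudoforest O8 :=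
  not_apexPseudoforest_of_grows
    [[5, 4, 3, 2], [6, 5, 4, 2], [6, 5, 4, 3], [4, 3, 2, 1, 0], [5, 3, 2, 1, 0]] (by decide)

theorem not_apex_O9 : ¬ ApexPseudoforest O9 :=
  not_apexPseudoforest_of_grows
    [[5, 4, 3, 2], [7, 3, 2, 1, 0], [8, 5, 4, 3], [6, 4, 2, 1, 0]] (by decide)

theorem not_apex_O10 : ¬ ApexPseudoforest O10 :=
  not_apexPseudoforest_of_grows
    [[4, 3, 2, 1, 0], [8, 7, 4, 1, 0], [6, 5, 3, 2, 1], [2, 8, 7, 6, 3, 0]] (by decide)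

theorem not_apex_O11 : ¬ ApexPseudoforest O11 :=
  not_apexPseudoforest_of_grows
    [[5, 4, 3, 2, 1, 0], [7, 6, 8, 2, 1, 0], [7, 6, 8, 5, 4, 3]] (by decide)

theorem not_apex_O12 : ¬ ApexPseudoforest O12 :=
  not_apexPseudoforest_of_grows
    [[8, 7, 6, 3, 2], [5, 4, 3, 2, 1, 0], [6, 8, 7, 2, 1, 0], [8, 7, 6, 5, 4, 3]] (by decide)

theorem not_apex_O13 : ¬ ApexPseudoforest O13 :=
  not_apexPseudoforest_of_grows
    [[8, 3, 2, 1, 0], [7, 6, 8, 5, 4, 3], [5, 4, 3, 2, 1, 0], [7, 6, 8, 2, 1, 0]] (by decide)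

theorem not_apex_O14 : ¬ ApexPseudoforest O14 :=
  not_apexPseudoforest_of_grows
    [[4, 2, 1, 0], [5, 4, 3, 2], [7, 6, 2, 1, 0], [3, 7, 6, 5, 4, 1]] (by decide)

theorem not_apex_O15 : ¬ ApexPseudoforest O15 :=
  not_apexPseudoforest_of_grows
    [[6, 4, 3, 2], [8, 7, 6, 5, 4], [4, 3, 2, 1, 0], [8, 7, 6, 2, 1, 0]] (by decide)

theorem not_isMinorOf_of_obs {V : Type} {G : SimpleGraph V} (h1 : ObsApexPseudoforest G)
    (h2 : ¬ InO G) {n : ℕ} {H : SimpleGraph (Fin n)}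
    (hH : (⟨n, H⟩ : (n : ℕ) × SimpleGraph (Fin n)) ∈ OList) (hna : ¬ ApexPseudoforest H) :
    ¬ IsMinorOf H G := fun hm =>
  hna (h1.2 _ H hm ⟨fun e => h2 ⟨_, hH, ⟨e.symm⟩⟩⟩)

/-- `S` is a connected set inside `W`. -/
def Piece (G : SimpleGraph V) (W S : Set V) : Prop := ConnSet G S ∧ S ⊆ W

/-- Disjointness of vertex sets. -/
def Apart (S T : Set V) : Prop := Disjoint S T

theorem Piece.conn {W S : Set V} (h : Piece G W S) : ConnSet G S := h.1

theorem Piece.union {W S T : Set V} (hS : Piece G W S) (hT : Piece G W T) (h : Touch G S T) :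
    Piece G W (S ∪ T) := ⟨hS.1.union_touch hT.1 h, Set.union_subset hS.2 hT.2⟩

theorem Apart.symm {S T : Set V} (h : Apart S T) : Apart T S := Disjoint.symm h

theorem apart_union_left {S T U : Set V} : Apart (S ∪ T) U ↔ Apart S U ∧ Apart T U :=
  Set.disjoint_union_left

theorem apart_union_right {S T U : Set V} : Apart U (S ∪ T) ↔ Apart U S ∧ Apart U T :=
  Set.disjoint_union_right

attribute [grind =] touch_union_left touch_union_right apart_union_left apart_union_right
attribute [grind →] Touch.symm Apart.symm Piece.conn
grind_pattern Piece.union => Piece G W (S ∪ T)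

theorem isMinorOf_mkGraph {n : ℕ} {E : List (ℕ × ℕ)} (L : List (Set V))
    (hn : L.length = n) (hc : ∀ A ∈ L, ConnSet G A) (hd : L.Pairwise Apart)
    (ht : ∀ e ∈ E, Touch G (L.getD e.1 ∅) (L.getD e.2 ∅)) :
    IsMinorOf (mkGraph n E) G := by
  subst hn
  refine ⟨fun i => L[i], fun i => connSet_iff.1 (hc _ (L.get_mem i)), fun i j hij => ?_,
    fun i j hij => ?_⟩
  · rcases lt_or_gt_of_ne hij with h | h
    · exact List.pairwise_iff_get.1 hd _ _ h
    · exact (List.pairwise_iff_get.1 hd _ _ h).symm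
  · rw [mkGraph, fromRel_adj] at hij
    rcases hij.2 with h | h
    · have := ht _ h
      rwa [List.getD_eq_getElem _ _ i.2, List.getD_eq_getElem _ _ j.2] at this
    · have := (ht _ h).symm
      rwa [List.getD_eq_getElem _ _ i.2, List.getD_eq_getElem _ _ j.2] at this

/-- The part `W` of `G` behind a cut vertex `v`, with a triangle model `D₁`, `D₂`, `D₃` on the
other side. -/
structure Lobe (G : SimpleGraph V) (v : V) (W D₁ D₂ D₃ : Set V) : Prop where
  excl : ∀ (n : ℕ) (H : SimpleGraph (Fin n)), (⟨n, H⟩ : (n : ℕ) × SimpleGraph (Fin n)) ∈ OList →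
    ¬ ApexPseudoforest H → ¬ IsMinorOf H G
  conn : ConnSet G W
  tri : Tri G D₁ D₂ D₃
  mem : v ∈ D₁
  disj₁ : Disjoint W D₁
  disj₂ : Disjoint W D₂
  disj₃ : Disjoint W D₃

section

variable {v : V} {W D₁ D₂ D₃ : Set V}

theorem Lobe.facts (h : Lobe G v W D₁ D₂ D₃) :
    (ConnSet G D₁ ∧ ConnSet G D₂ ∧ ConnSet G D₃) ∧ (Apart D₁ D₂ ∧ Apart D₁ D₃ ∧ Apart D₂ D₃) ∧
    (Touch G D₁ D₂ ∧ Touch G D₁ D₃ ∧ Touch G D₂ D₃) ∧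
    (∀ A, Piece G W A → Apart A D₁ ∧ Apart A D₂ ∧ Apart A D₃) ∧ ∀ A, Touch G A {v} → Touch G A D₁ :=
  ⟨h.tri.1, h.tri.2.1, h.tri.2.2, fun _ hA => ⟨h.disj₁.mono_left hA.2, h.disj₂.mono_left hA.2,
    h.disj₃.mono_left hA.2⟩, fun _ hA => hA.mono subset_rfl (Set.singleton_subset_iff.2 h.mem)⟩

/-- The members of `L` are pairwise disjoint connected subsets of `W`. -/
def Pieces (G : SimpleGraph V) (W : Set V) (L : List (Set V)) : Prop :=
  (∀ A ∈ L, Piece G W A) ∧ L.Pairwise Apart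

theorem Lobe.excl_O4 (h : Lobe G v W D₁ D₂ D₃) {P Q R S T : Set V}
    (hL : Pieces G W [P, Q, R, S, T] := by simp [Pieces]; grind)
    (hN : Touch G P {v} ∧ Touch G Q {v} := by grind)
    (ht : Touch G P Q ∧ Touch G P R ∧ Touch G Q R ∧ Touch G R S ∧ Touch G R T ∧
      Touch G S T := by grind) : False := by
  obtain ⟨dc, ds, dt, dw, dn⟩ := h.facts
  simp only [Pieces, List.forall_mem_cons, List.pairwise_cons] at hL
  refine h.excl _ O4 (by simp [OList]) not_apex_O4
    (isMinorOf_mkGraph [D₂, D₃, D₁, P, Q, R, S, T] rfl ?_ ?_ ?_) <;>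
  clear h <;> simp <;> grind

theorem Lobe.excl_O5 (h : Lobe G v W D₁ D₂ D₃) {P Q S T Y : Set V}
    (hL : Pieces G W [P, Q, S, T, Y] := by simp [Pieces]; grind)
    (hN : Touch G P {v} ∧ Touch G Q {v} := by grind)
    (ht : Touch G P Q ∧ Touch G P S ∧ Touch G Q T ∧ Touch G S T ∧ Touch G S Y ∧
      Touch G T Y := by grind) : False := by
  obtain ⟨dc, ds, dt, dw, dn⟩ := h.facts
  simp only [Pieces, List.forall_mem_cons, List.pairwise_cons] at hL
  refine h.excl _ O5 (by simp [OList]) not_apex_O5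
    (isMinorOf_mkGraph [D₂, D₃, D₁, P, Q, S, T, Y] rfl ?_ ?_ ?_) <;>
  clear h <;> simp <;> grind

theorem Lobe.excl_O6 (h : Lobe G v W D₁ D₂ D₃) {P Q F S T : Set V}
    (hL : Pieces G W [P, Q, F, S, T] := by simp [Pieces]; grind)
    (hN : Touch G P {v} ∧ Touch G Q {v} := by grind)
    (ht : Touch G P Q ∧ Touch G P F ∧ Touch G Q F ∧ Touch G S P ∧ Touch G S F ∧ Touch G T Q ∧
      Touch G T F := by grind) : False := by
  obtain ⟨dc, ds, dt, dw, dn⟩ := h.facts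
  simp only [Pieces, List.forall_mem_cons, List.pairwise_cons] at hL
  refine h.excl _ O6 (by simp [OList]) not_apex_O6
    (isMinorOf_mkGraph [D₂, D₃, D₁, P, Q, F, S, T] rfl ?_ ?_ ?_) <;>
  clear h <;> simp <;> grind

theorem Lobe.excl_O7 (h : Lobe G v W D₁ D₂ D₃) {A B C E : Set V}
    (hL : Pieces G W [A, B, C, E] := by simp [Pieces]; grind)
    (hN : Touch G C {v} ∧ Touch G E {v} := by grind)
    (ht : Touch G A B ∧ Touch G A C ∧ Touch G A E ∧ Touch G B C ∧ Touch G B E := by grind) :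
    False := by
  obtain ⟨dc, ds, dt, dw, dn⟩ := h.facts
  simp only [Pieces, List.forall_mem_cons, List.pairwise_cons] at hL
  refine h.excl _ O7 (by simp [OList]) not_apex_O7
    (isMinorOf_mkGraph [D₂, D₃, A, B, C, E, D₁] rfl ?_ ?_ ?_) <;>
  clear h <;> simp <;> grind

theorem Lobe.excl_O8 (h : Lobe G v W D₁ D₂ D₃) {A B C E : Set V}
    (hL : Pieces G W [A, B, C, E] := by simp [Pieces]; grind)
    (hN : Touch G A {v} ∧ Touch G B {v} ∧ Touch G C {v} := by grind)
    (ht : Touch G A B ∧ Touch G A C ∧ Touch G A E ∧ Touch G B C ∧ Touch G B E := by grind) :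
    False := by
  obtain ⟨dc, ds, dt, dw, dn⟩ := h.facts
  simp only [Pieces, List.forall_mem_cons, List.pairwise_cons] at hL
  refine h.excl _ O8 (by simp [OList]) not_apex_O8
    (isMinorOf_mkGraph [D₂, D₃, D₁, C, A, B, E] rfl ?_ ?_ ?_) <;>
  clear h <;> simp <;> grind

theorem Lobe.excl_O9 (h : Lobe G v W D₁ D₂ D₃) {A B C E S T : Set V}
    (hL : Pieces G W [A, B, C, E, S, T] := by simp [Pieces]; grind)
    (hN : Touch G A {v} ∧ Touch G B {v} ∧ Touch G S {v} ∧ Touch G T {v} := by grind)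
    (ht : Touch G A B ∧ Touch G A C ∧ Touch G A E ∧ Touch G B C ∧ Touch G B E ∧ Touch G S A ∧
      Touch G T B := by grind) : False := by
  obtain ⟨dc, ds, dt, dw, dn⟩ := h.facts
  simp only [Pieces, List.forall_mem_cons, List.pairwise_cons] at hL
  refine h.excl _ O9 (by simp [OList]) not_apex_O9
    (isMinorOf_mkGraph [D₂, D₃, D₁, A, B, C, T, S, E] rfl ?_ ?_ ?_) <;>
  clear h <;> simp <;> grind

theorem Lobe.excl_O10 (h : Lobe G v W D₁ D₂ D₃) {X A B S T P : Set V}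
    (hL : Pieces G W [X, A, B, S, T, P] := by simp [Pieces]; grind)
    (hN : Touch G A {v} ∧ Touch G P {v} ∧ Touch G S {v} := by grind)
    (ht : Touch G X A ∧ Touch G X B ∧ Touch G A B ∧ Touch G X S ∧ Touch G X T ∧ Touch G S T ∧
      Touch G P A := by grind) : False := by
  obtain ⟨dc, ds, dt, dw, dn⟩ := h.facts
  simp only [Pieces, List.forall_mem_cons, List.pairwise_cons] at hL
  refine h.excl _ O10 (by simp [OList]) not_apex_O10
    (isMinorOf_mkGraph [D₁, A, X, S, P, B, T, D₂, D₃] rfl ?_ ?_ ?_) <;>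
  clear h <;> simp <;> grind

theorem Lobe.excl_O11 (h : Lobe G v W D₁ D₂ D₃) {A B C P Q R : Set V}
    (hL : Pieces G W [A, B, C, P, Q, R] := by simp [Pieces]; grind)
    (hN : Touch G B {v} ∧ Touch G Q {v} := by grind)
    (ht : Touch G A B ∧ Touch G A C ∧ Touch G B C ∧ Touch G P Q ∧ Touch G P R ∧ Touch G Q R ∧
      Touch G A P := by grind) : False := by
  obtain ⟨dc, ds, dt, dw, dn⟩ := h.facts
  simp only [Pieces, List.forall_mem_cons, List.pairwise_cons] at hL
  refine h.excl _ O11 (by simp [OList]) not_apex_O11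
    (isMinorOf_mkGraph [C, B, A, P, Q, R, D₂, D₃, D₁] rfl ?_ ?_ ?_) <;>
  clear h <;> simp <;> grind

theorem Lobe.excl_O12 (h : Lobe G v W D₁ D₂ D₃) {A B C P Q R : Set V}
    (hL : Pieces G W [A, B, C, P, Q, R] := by simp [Pieces]; grind)
    (hN : Touch G A {v} ∧ Touch G Q {v} := by grind)
    (ht : Touch G A B ∧ Touch G A C ∧ Touch G B C ∧ Touch G P Q ∧ Touch G P R ∧ Touch G Q R ∧
      Touch G A P := by grind) : False := by
  obtain ⟨dc, ds, dt, dw, dn⟩ := h.facts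
  simp only [Pieces, List.forall_mem_cons, List.pairwise_cons] at hL
  refine h.excl _ O12 (by simp [OList]) not_apex_O12
    (isMinorOf_mkGraph [D₂, D₃, D₁, A, B, C, P, Q, R] rfl ?_ ?_ ?_) <;>
  clear h <;> simp <;> grind

theorem Lobe.excl_O13 (h : Lobe G v W D₁ D₂ D₃) {A B C P Q R : Set V}
    (hL : Pieces G W [A, B, C, P, Q, R] := by simp [Pieces]; grind)
    (hN : Touch G A {v} ∧ Touch G P {v} := by grind)
    (ht : Touch G A B ∧ Touch G A C ∧ Touch G B C ∧ Touch G P Q ∧ Touch G P R ∧ Touch G Q R ∧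
      Touch G A P := by grind) : False := by
  obtain ⟨dc, ds, dt, dw, dn⟩ := h.facts
  simp only [Pieces, List.forall_mem_cons, List.pairwise_cons] at hL
  refine h.excl _ O13 (by simp [OList]) not_apex_O13
    (isMinorOf_mkGraph [D₂, D₃, D₁, A, B, C, Q, R, P] rfl ?_ ?_ ?_) <;>
  clear h <;> simp <;> grind

theorem Lobe.excl_O14 (h : Lobe G v W D₁ D₂ D₃) {A B C E S : Set V}
    (hL : Pieces G W [A, B, C, E, S] := by simp [Pieces]; grind)
    (hN : Touch G A {v} ∧ Touch G C {v} ∧ Touch G S {v} := by grind)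
    (ht : Touch G A B ∧ Touch G A C ∧ Touch G A E ∧ Touch G B C ∧ Touch G B E ∧
      Touch G S C := by grind) : False := by
  obtain ⟨dc, ds, dt, dw, dn⟩ := h.facts
  simp only [Pieces, List.forall_mem_cons, List.pairwise_cons] at hL
  refine h.excl _ O14 (by simp [OList]) not_apex_O14
    (isMinorOf_mkGraph [S, D₁, C, B, A, E, D₂, D₃] rfl ?_ ?_ ?_) <;>
  clear h <;> simp <;> grind

theorem Lobe.excl_O15 (h : Lobe G v W D₁ D₂ D₃) {X A B S T P : Set V}
    (hL : Pieces G W [X, A, B, S, T, P] := by simp [Pieces]; grind)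
    (hN : Touch G X {v} ∧ Touch G A {v} ∧ Touch G P {v} := by grind)
    (ht : Touch G X A ∧ Touch G X B ∧ Touch G A B ∧ Touch G X S ∧ Touch G X T ∧ Touch G S T ∧
      Touch G P A := by grind) : False := by
  obtain ⟨dc, ds, dt, dw, dn⟩ := h.facts
  simp only [Pieces, List.forall_mem_cons, List.pairwise_cons] at hL
  refine h.excl _ O15 (by simp [OList]) not_apex_O15
    (isMinorOf_mkGraph [D₂, D₃, D₁, P, A, B, X, S, T] rfl ?_ ?_ ?_) <;>
  clear h <;> simp <;> grind

end

/-- There are distinct vertices of `S`, one with a neighbour in `L` and one with a neighbour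
in `M`. -/
def TwoTouch (G : SimpleGraph V) (S L M : Set V) : Prop :=
  ∃ a ∈ S, ∃ b ∈ S, a ≠ b ∧ (∃ x ∈ L, G.Adj a x) ∧ ∃ y ∈ M, G.Adj b y

theorem Piece.split [Finite V] {W S L M : Set V} (hS : Piece G W S) (h : TwoTouch G S L M) :
    ∃ X Y, S = X ∪ Y ∧ Piece G W X ∧ Piece G W Y ∧ Apart X Y ∧ Touch G X Y ∧ Touch G X L ∧
      Touch G Y M := by
  obtain ⟨a, ha, b, hb, hab, ⟨x, hx, hax⟩, y, hy, hby⟩ := h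
  obtain ⟨X, Y, rfl, hd, haX, hbY, hX, hY, ht⟩ := hS.1.split ha hb hab
  exact ⟨X, Y, rfl, ⟨hX, Set.subset_union_left.trans hS.2⟩,
    ⟨hY, Set.subset_union_right.trans hS.2⟩, hd, ht, ⟨a, haX, x, hx, hax⟩, b, hbY, y, hy, hby⟩

theorem Piece.tri {W A B C : Set V} (hK : Piece G W (A ∪ B ∪ C)) (h : Tri G A B C) :
    (Piece G W A ∧ Piece G W B ∧ Piece G W C) ∧ (Apart A B ∧ Apart A C ∧ Apart B C) ∧
      Touch G A B ∧ Touch G A C ∧ Touch G B C := by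
  have := hK.2
  exact ⟨⟨⟨h.1.1, by grind⟩, ⟨h.1.2.1, by grind⟩, h.1.2.2, by grind⟩, h.2⟩

/-- A connected set with a cycle which touches `L` and `M` contains a spanning triangle model
such that one part touches `L` and the same or another part touches `M`. -/
theorem Piece.spanning [Finite V] {W K L M : Set V} (hK : Piece G W K) (hc : Cyc G K)
    (hL : Touch G K L) (hM : Touch G K M) :
    ∃ A B C, K = A ∪ B ∪ C ∧ ((Piece G W A ∧ Piece G W B ∧ Piece G W C) ∧
      (Apart A B ∧ Apart A C ∧ Apart B C) ∧ Touch G A B ∧ Touch G A C ∧ Touch G B C) ∧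
      Touch G A L ∧ (Touch G A M ∨ Touch G B M) := by
  obtain ⟨a, ha, x, hx, hax⟩ := hL
  obtain ⟨A, B, C, rfl, ht, haA⟩ := hc.spanning_at hK.1 ha
  have hL : Touch G A L := ⟨a, haA, x, hx, hax⟩
  simp only [touch_union_left] at hM
  rcases hM with (hM | hM) | hM
  · exact ⟨A, B, C, rfl, hK.tri ht, hL, .inl hM⟩
  · exact ⟨A, B, C, rfl, hK.tri ht, hL, .inr hM⟩
  · have he : A ∪ B ∪ C = A ∪ C ∪ B := by grind
    exact ⟨A, C, B, he, Piece.tri (he ▸ hK) ht.rotate.rotate.swap, hL, .inr hM⟩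

/-- Two vertices attaching `K` to `L` and `M` are either separated by a spanning triangle model
of `K`, or one of them lies in a branch hanging off the part containing the other. -/
theorem Piece.separate [Finite V] {W K L M : Set V} (hK : Piece G W K) (hc : Cyc G K)
    (h : TwoTouch G K L M) :
    (∃ A B C, K = A ∪ B ∪ C ∧ (Piece G W A ∧ Piece G W B ∧ Piece G W C) ∧
      (Apart A B ∧ Apart A C ∧ Apart B C) ∧ (Touch G A B ∧ Touch G A C ∧ Touch G B C) ∧
      Touch G A L ∧ Touch G B M) ∨
    ∃ X X' B C, K = X ∪ X' ∪ B ∪ C ∧ (Piece G W X ∧ Piece G W X' ∧ Piece G W B ∧ Piece G W C) ∧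
      (Apart X X' ∧ Apart X B ∧ Apart X C ∧ Apart X' B ∧ Apart X' C ∧ Apart B C) ∧
      (Touch G X X' ∧ Touch G X B ∧ Touch G X C ∧ Touch G B C) ∧
      (Touch G X L ∧ Touch G X' M ∨ Touch G X M ∧ Touch G X' L) := by
  obtain ⟨a, ha, b, hb, hab, ⟨x, hx, hax⟩, y, hy, hby⟩ := h
  rcases hc.separate hK.1 ha hb hab with ⟨A, B, C, rfl, ht, haA, hbB⟩ |
    ⟨X, X', B, C, rfl, ht, hX', hd, hXX', hab⟩
  · have := hK.tri ht
    exact .inl ⟨A, B, C, rfl, this.1, this.2.1, this.2.2, ⟨a, haA, x, hx, hax⟩,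
      b, hbB, y, hy, hby⟩
  · have hs := hK.2
    refine .inr ⟨X, X', B, C, rfl, ⟨⟨ht.1.1, by grind⟩, ⟨hX', by grind⟩, ⟨ht.1.2.1, by grind⟩,
      ht.1.2.2, by grind⟩, ⟨hd.1, ht.2.1.1, ht.2.1.2.1, hd.2.1, hd.2.2, ht.2.1.2.2⟩,
      ⟨hXX', ht.2.2⟩, ?_⟩
    rcases hab with ⟨h1, h2⟩ | ⟨h1, h2⟩
    · exact .inl ⟨⟨a, h1, x, hx, hax⟩, b, h2, y, hy, hby⟩
    · exact .inr ⟨⟨b, h1, y, hy, hby⟩, a, h2, x, hx, hax⟩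

section

variable {v : V} {W D₁ D₂ D₃ : Set V}

theorem Lobe.not_cyc_cyc [Finite V] (h : Lobe G v W D₁ D₂ D₃) {K L : Set V}
    (hK : Piece G W K) (hL : Piece G W L) (hd : Apart K L) (ht : Touch G K L)
    (hKc : Cyc G K) (hLc : Cyc G L) (hKv : Touch G K {v}) (hLv : Touch G L {v}) : False := by
  obtain ⟨A, B, C, rfl, hABC, hA, hv⟩ := hK.spanning hKc ht hKv
  obtain ⟨P, Q, R, rfl, hPQR, hP, hv'⟩ := hL.spanning hLc hA.symm hLv
  clear hK hL hKc hLc hKv hLv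
  rcases hv with hv | hv <;> rcases hv' with hv' | hv'
  · exact h.excl_O13 (A := A) (B := B) (C := C) (P := P) (Q := Q) (R := R)
  · exact h.excl_O12 (A := A) (B := B) (C := C) (P := P) (Q := Q) (R := R)
  · exact h.excl_O12 (A := P) (B := Q) (C := R) (P := A) (Q := B) (R := C)
  · exact h.excl_O11 (A := A) (B := B) (C := C) (P := P) (Q := Q) (R := R)

theorem Lobe.not_cyc_two [Finite V] (h : Lobe G v W D₁ D₂ D₃) {K Y Z : Set V}
    (hp : Piece G W K ∧ Piece G W Y ∧ Piece G W Z) (hd : Apart K Y ∧ Apart K Z ∧ Apart Y Z)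
    (hc : Cyc G K) (hv : Touch G K {v} ∧ Touch G Y {v} ∧ Touch G Z {v}) (ht : Touch G Y Z)
    (h2 : TwoTouch G K Y Y) : False := by
  rcases hp.1.separate hc h2 with ⟨A, B, C, rfl, hpA, hdA, htA, hYA, hYB⟩ |
    ⟨X, X', B, C, rfl, hpA, hdA, htA, hYX⟩
  · simp only [touch_union_left] at hv
    rcases hv.1 with (hv' | hv') | hv'
    · exact h.excl_O14 (A := A) (B := B) (C := Y) (E := C) (S := Z)
    · exact h.excl_O14 (A := B) (B := A) (C := Y) (E := C) (S := Z)
    · exact h.excl_O7 (A := A) (B := B) (C := Y) (E := C)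
  · simp only [touch_union_left] at hv
    rcases hv.1 with ((hv' | hv') | hv') | hv'
    · exact h.excl_O15 (X := X) (A := Y) (B := X') (S := B) (T := C) (P := Z)
    · exact h.excl_O4 (P := Y) (Q := X') (R := X) (S := B) (T := C)
    · exact h.excl_O10 (X := X) (A := Y) (B := X') (S := B) (T := C) (P := Z)
    · exact h.excl_O10 (X := X) (A := Y) (B := X') (S := C) (T := B) (P := Z)

theorem Lobe.not_cyc_both [Finite V] (h : Lobe G v W D₁ D₂ D₃) {K Y Z : Set V}
    (hp : Piece G W K ∧ Piece G W Y ∧ Piece G W Z) (hd : Apart K Y ∧ Apart K Z ∧ Apart Y Z)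
    (hc : Cyc G K) (hv : Touch G Y {v} ∧ Touch G Z {v})
    (ht : Touch G Y Z ∧ Touch G K Y ∧ Touch G K Z) : False := by
  obtain ⟨a, ha, x, hx, hax⟩ := ht.2.1
  obtain ⟨b, hb, y, hy, hby⟩ := ht.2.2
  rcases eq_or_ne a b with rfl | hab
  · obtain ⟨A, B, C, rfl, htri, haA⟩ := hc.spanning_at hp.1.1 ha
    have := hp.1.tri htri
    have h1 : Touch G A Y := ⟨a, haA, x, hx, hax⟩
    have h2 : Touch G A Z := ⟨a, haA, y, hy, hby⟩
    exact h.excl_O4 (P := Y) (Q := Z) (R := A) (S := B) (T := C)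
  · rcases hp.1.separate hc ⟨a, ha, b, hb, hab, ⟨x, hx, hax⟩, y, hy, hby⟩ with
      ⟨A, B, C, rfl, hpA, hdA, htA, hYA, hYB⟩ | ⟨X, X', B, C, rfl, hpA, hdA, htA, hYX | hYX⟩
    · exact h.excl_O5 (P := Y) (Q := Z) (S := A) (T := B) (Y := C)
    · exact h.excl_O4 (P := Y) (Q := Z ∪ X') (R := X) (S := B) (T := C)
    · exact h.excl_O4 (P := Z) (Q := Y ∪ X') (R := X) (S := B) (T := C)

theorem Lobe.not_cluster [Finite V] (h : Lobe G v W D₁ D₂ D₃) {P Q R : Set V}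
    (hp : Piece G W P ∧ Piece G W Q ∧ Piece G W R) (hd : Apart P Q ∧ Apart P R ∧ Apart Q R)
    (hv : Touch G P {v} ∧ Touch G Q {v} ∧ Touch G R {v})
    (ht : Touch G P Q ∧ Touch G P R ∧ Touch G Q R) (h2 : TwoTouch G P Q Q) : False := by
  obtain ⟨U, U', rfl, hU, hU', hUd, hUt, hUQ, hUQ'⟩ := hp.1.split h2
  have key : ∀ U U', Piece G W U → Piece G W U' → Apart U U' → Touch G U U' → Touch G U Q →
      Touch G U' Q → Touch G U R ∨ Touch G U' R → Touch G U {v} → Apart U Q ∧ Apart U' Q →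
      Apart U R ∧ Apart U' R → False := by
    intro U U' _ _ _ _ _ _ hR hv' _ _
    rcases hR with hR | hR
    · exact h.excl_O8 (A := U) (B := Q) (C := R) (E := U')
    · exact h.excl_O7 (A := U') (B := Q) (C := R) (E := U)
  grind

theorem Lobe.not_three [Finite V] (h : Lobe G v W D₁ D₂ D₃) {K Y Z : Set V}
    (hp : Piece G W K ∧ Piece G W Y ∧ Piece G W Z) (hd : Apart K Y ∧ Apart K Z ∧ Apart Y Z)
    (hv : Touch G Y {v} ∧ Touch G Z {v}) (ht : Touch G Y Z) (h2 : TwoTouch G K {v} {v})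
    (h3 : ∃ a b c, (a ∈ K ∧ b ∈ K ∧ c ∈ K) ∧ (a ≠ b ∧ a ≠ c ∧ b ≠ c) ∧
      (∃ y ∈ Y, G.Adj a y) ∧ (∃ y ∈ Y, G.Adj b y) ∧ ∃ y ∈ Y, G.Adj c y) : False := by
  obtain ⟨a, b, c, ⟨ha, hb, hc⟩, ⟨hab, hac, hbc⟩, haY, hbY, hcY⟩ := h3
  obtain ⟨T, A, B, rfl, hTA, hTB, hAB, hT, hA, hB, htA, htB, ⟨a', ha', ha''⟩, ⟨b', hb', hb''⟩,
    c', hc', hc''⟩ := hp.1.1.tripod (N := {x | ∃ y ∈ Y, G.Adj x y}) ha hb hc hab hac hbc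
      ⟨haY, hbY, hcY⟩
  have hTY : Touch G T Y := ⟨a', ha', ha''⟩
  have hAY : Touch G A Y := ⟨b', hb', hb''⟩
  have hBY : Touch G B Y := ⟨c', hc', hc''⟩
  clear ha hb hc hab hac hbc haY hbY hcY ha' hb' hc' ha'' hb'' hc'' a b c a' b' c'
  have hs := hp.1.2
  replace hT : Piece G W T := ⟨hT, by grind⟩
  replace hA : Piece G W A := ⟨hA, by grind⟩
  replace hB : Piece G W B := ⟨hB, by grind⟩
  change Apart T A at hTA
  change Apart T B at hTB
  change Apart A B at hAB
  obtain ⟨hpK, hpY, hpZ⟩ := hp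
  clear hpK hs
  have twoA : ∀ A B, Piece G W A → Piece G W B → Apart T A → Apart T B → Apart A B →
      Touch G T A → Touch G T B → Touch G A Y → Touch G B Y → Apart A Y → Apart A Z →
      Apart B Y → Apart B Z → TwoTouch G A {v} {v} → False := by
    intro A B hA hB _ _ _ _ _ _ _ _ _ _ _ h2
    obtain ⟨X, X', rfl, hX, hX', _, _, _, _⟩ := hA.split h2
    have key : ∀ X X', Piece G W X → Piece G W X' → Apart X X' → Touch G X X' →
      Touch G X {v} → Touch G X' {v} → Apart X T → Apart X' T → Apart X Y → Apart X' Y →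
      Apart X B → Apart X' B → Touch G T X → Touch G X Y ∨ Touch G X' Y → False := by
      intro X X' _ _ _ _ _ _ _ _ _ _ _ _ _ hXY
      rcases hXY with hXY | hXY
      · exact h.excl_O14 (A := Y) (B := T) (C := X) (E := B) (S := X')
      · exact h.excl_O8 (A := Y) (B := T ∪ X) (C := X') (E := B)
    clear h2
    grind
  have twoT : TwoTouch G T {v} {v} → False := by
    intro h2
    clear twoA
    obtain ⟨X, X', rfl, hX, hX', _, _, _, _⟩ := hT.split h2
    have key : ∀ X X', Piece G W X → Piece G W X' → Apart X X' → Touch G X X' →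
      Touch G X {v} → Touch G X' {v} → Apart X Y → Apart X' Y →
      Apart X A → Apart X' A → Apart X B → Apart X' B → Apart X Z → Apart X' Z →
      (Touch G X A ∨ Touch G X' A) → (Touch G X B ∨ Touch G X' B) →
      (Touch G X Y ∨ Touch G X' Y) → (Touch G X A ∧ Touch G X B ∨ Touch G X A ∧ Touch G X Y ∨
        Touch G X B ∧ Touch G X Y) → False := by
      intro X X' _ _ _ _ _ _ _ _ _ _ _ _ _ _ h1 h2 h3 h4
      by_cases hXA : Touch G X A
      · by_cases hXB : Touch G X B
        · by_cases hXY : Touch G X Y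
          · exact h.excl_O9 (A := X) (B := Y) (C := A) (E := B) (S := X') (T := Z)
          · exact h.excl_O8 (A := X ∪ B) (B := Y) (C := X') (E := A)
        · exact h.excl_O8 (A := Y) (B := X) (C := B ∪ X') (E := A)
      · exact h.excl_O8 (A := Y) (B := X) (C := A ∪ X') (E := B)
    clear h2
    grind
  obtain ⟨n, hn, n', hn', hnn', hnv, hnv'⟩ := h2
  have t : ∀ {n S}, n ∈ S → (∃ y ∈ ({v} : Set V), G.Adj n y) → Touch G S {v} :=
    fun hn h => ⟨_, hn, h⟩
  rcases hn with (hn | hn) | hn <;> rcases hn' with (hn' | hn') | hn' <;>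
    have h1 := t hn hnv <;> have h1' := t hn' hnv'
  · exact twoT ⟨n, hn, n', hn', hnn', hnv, hnv'⟩
  · clear twoA twoT
    exact h.excl_O8 (A := T) (B := Y) (C := A) (E := B)
  · clear twoA twoT
    exact h.excl_O8 (A := T) (B := Y) (C := B) (E := A)
  · clear twoA twoT
    exact h.excl_O8 (A := T) (B := Y) (C := A) (E := B)
  · exact twoA A B hA hB hTA hTB hAB htA htB hAY hBY (by grind) (by grind) (by grind) (by grind)
      ⟨n, hn, n', hn', hnn', hnv, hnv'⟩
  · clear twoA twoT
    exact h.excl_O7 (A := T) (B := Y) (C := A) (E := B)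
  · clear twoA twoT
    exact h.excl_O8 (A := T) (B := Y) (C := B) (E := A)
  · clear twoA twoT
    exact h.excl_O7 (A := T) (B := Y) (C := A) (E := B)
  · exact twoA B A hB hA hTB hTA hAB.symm htB htA hBY hAY (by grind) (by grind) (by grind)
      (by grind) ⟨n, hn, n', hn', hnn', hnv, hnv'⟩

end

theorem Cyc.two_le_rk [Finite V] {S : Set V} (hS : ConnSet G S) (hc : Cyc G S) : 2 ≤ rk G S := by
  obtain ⟨A, B, C, hsub, ht⟩ := hc
  refine le_trans ?_ (ht.conn.rk_mono hS hsub)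
  rw [rk_union (by simpa using ht.2.1.2), rk_union ht.2.1.1, crossing_ncard_union_left ht.2.1.1]
  have := one_le_crossing ht.2.2.1
  have := one_le_crossing ht.2.2.2.1
  have := one_le_crossing ht.2.2.2.2
  have := ht.1.1.rk_nonneg
  have := ht.1.2.1.rk_nonneg
  have := ht.1.2.2.rk_nonneg
  push_cast
  omega

theorem twoTouch_of_crossing [Finite V] {X Y : Set V} (h : 2 ≤ (crossing G X Y).ncard) :
    TwoTouch G X Y Y ∨ TwoTouch G Y X X := by
  obtain ⟨a, ha, b, hb, a', ha', b', hb', h1, h2, h3 | h3⟩ := exists_two_of_crossing h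
  · exact .inl ⟨a, ha, a', ha', h3, ⟨b, hb, h1⟩, b', hb', h2⟩
  · exact .inr ⟨b, hb, b', hb', h3, ⟨a, ha, h1.symm⟩, a', ha', h2.symm⟩

theorem TwoTouch.mono {S S' L M L' M' : Set V} (h : TwoTouch G S L M) (hS : S ⊆ S') (hL : L ⊆ L')
    (hM : M ⊆ M') : TwoTouch G S' L' M' := by
  obtain ⟨a, ha, b, hb, hab, ⟨x, hx, hax⟩, y, hy, hby⟩ := h
  exact ⟨a, hS ha, b, hS hb, hab, ⟨x, hL hx, hax⟩, y, hM hy, hby⟩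

theorem TwoTouch.touch {S L M : Set V} (h : TwoTouch G S L M) : Touch G S L := by
  obtain ⟨a, ha, b, hb, hab, ⟨x, hx, hax⟩, y, hy, hby⟩ := h
  exact ⟨a, ha, x, hx, hax⟩

/-- If all edges between `X` and `Y` have the same endpoint `a` in `X`, then a connected set
avoiding `a` stays on one side. -/
theorem ConnSet.subset_or_subset {K X Y : Set V} (hK : ConnSet G K) (hKs : K ⊆ X ∪ Y) {a : V}
    (ha : a ∉ K) (h : ∀ x ∈ X, ∀ y ∈ Y, G.Adj x y → x = a) : K ⊆ X ∨ K ⊆ Y := by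
  by_cases hne : (K ∩ X).Nonempty
  · left
    have := hK.eq_of_closed Set.inter_subset_left hne fun x hx y hy hxy => by
      rcases hKs hy with hy' | hy'
      · exact ⟨hy, hy'⟩
      · exact absurd (h x hx.2 y hy' hxy ▸ hx.1) ha
    exact this ▸ Set.inter_subset_right
  · right
    intro x hx
    exact (hKs hx).resolve_left fun h => hne ⟨x, hx, h⟩

/-- `K` together with `v` contains a cycle, provided that `K` is connected. -/
def Rich (G : SimpleGraph V) (v : V) (K : Set V) : Prop :=
  TwoTouch G K {v} {v} ∨ Touch G K {v} ∧ Cyc G K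

theorem Rich.mono {v : V} {K L : Set V} (h : Rich G v K) (hKL : K ⊆ L) : Rich G v L :=
  h.imp (fun h => h.mono hKL subset_rfl subset_rfl) fun h => ⟨h.1.mono hKL subset_rfl, h.2.mono hKL⟩

theorem Rich.touch {v : V} {K : Set V} (h : Rich G v K) : Touch G K {v} :=
  h.elim TwoTouch.touch And.left

/-- `X` and `Y` split `W` into two connected parts. -/
def Halves (G : SimpleGraph V) (W X Y : Set V) : Prop :=
  W = X ∪ Y ∧ Piece G W X ∧ Piece G W Y ∧ Apart X Y ∧ Touch G X Y

theorem Halves.symm {W X Y : Set V} (h : Halves G W X Y) : Halves G W Y X :=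
  ⟨by rw [h.1, Set.union_comm], h.2.2.1, h.2.1, h.2.2.2.1.symm, h.2.2.2.2.symm⟩

/-- Every vertex of `W` is avoided by a rich connected subset. -/
theorem exists_halves [Finite V] {v : V} {W : Set V} (hW : ConnSet G W)
    (hstar : ∀ x ∈ W, ∃ K ⊆ W, x ∉ K ∧ ConnSet G K ∧ Rich G v K) {x : V} (hx : x ∈ W) :
    ∃ X Y, Halves G W X Y ∧ x ∈ Y ∧ Rich G v X := by
  obtain ⟨K, hKW, hxK, hK, hR⟩ := hstar x hx
  obtain ⟨X, hKX, hXU, hX, hcl⟩ := hK.exists_comp (U := W \ {x}) fun y hy =>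
    ⟨hKW hy, fun h => hxK (h ▸ hy)⟩
  have hY := hW.diff_comp (connSet_singleton x) (by simpa using hx)
    (K := X) (by simpa using fun h => (hXU h).2 rfl) hcl
  have hXW : X ⊆ W := fun y hy => (hXU hy).1
  exact ⟨X, W \ X, ⟨(Set.union_sdiff_cancel hXW).symm, ⟨hX, hXW⟩, ⟨hY, Set.sdiff_subset⟩,
    Set.disjoint_sdiff_right, hW.touch_diff hXW hX.1 hY.1⟩, ⟨hx, fun h => (hXU h).2 rfl⟩,
    hR.mono hKX⟩

theorem not_DB_DB [Finite V] (hex : ∀ (n : ℕ) (H : SimpleGraph (Fin n)),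
    (⟨n, H⟩ : (n : ℕ) × SimpleGraph (Fin n)) ∈ OList → ¬ ApexPseudoforest H → ¬ IsMinorOf H G)
    {S T : Set V} (hS : DB G S) (hT : DB G T) (hd : Disjoint S T) : False := by
  have hsep : ∀ {A B}, A ⊆ S → B ⊆ T → Apart A B := fun hA hB => Set.disjoint_of_subset hA hB hd
  rcases hS with ⟨A, B, C, E, hS, h⟩ | ⟨X, A, B, C, E, hS, h⟩ <;>
  rcases hT with ⟨A', B', C', E', hT, h'⟩ | ⟨X', A', B', C', E', hT, h'⟩ <;>
  simp only [Set.union_subset_iff] at hS hT <;>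
  simp only [Diamond, Butterfly, Tri] at h h'
  · refine hex _ O1 (by simp [OList]) not_apex_O1 (isMinorOf_mkGraph [A, B, C, E, A', B', C', E']
      rfl ?_ ?_ ?_) <;> clear hex <;> simp <;> simp_all [Apart]
  · refine hex _ O3 (by simp [OList]) not_apex_O3 (isMinorOf_mkGraph
      [A, B, C, E, X', A', B', C', E'] rfl ?_ ?_ ?_) <;> clear hex <;> simp <;> simp_all [Apart]
  · refine hex _ O3 (by simp [OList]) not_apex_O3 (isMinorOf_mkGraph
      [A', B', C', E', X, A, B, C, E] rfl ?_ ?_ ?_) <;> clear hex <;> simp <;>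
      simp_all [Apart, disjoint_comm]
  · refine hex _ O2 (by simp [OList]) not_apex_O2 (isMinorOf_mkGraph
      [X, A, B, C, E, X', A', B', C', E'] rfl ?_ ?_ ?_) <;> clear hex <;> simp <;>
      simp_all [Apart]

section

variable {v : V} {W D₁ D₂ D₃ : Set V}

theorem Lobe.rk_le_two [Finite V] (h : Lobe G v W D₁ D₂ D₃) {K L : Set V} (hK : Piece G W K)
    (hL : Piece G W L) (hd : Apart K L) (hR : Rich G v L) : rk G K ≤ 2 := by
  refine hK.1.rk_le_two fun hDB => ?_
  obtain ⟨dc, ds, dt, dw, dn⟩ := h.facts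
  refine not_DB_DB h.excl hDB (T := L ∪ (D₁ ∪ D₂ ∪ D₃)) (.inr ?_) ?_
  · rcases hR with h2 | ⟨hv, hc⟩
    · obtain ⟨X, Y, rfl, hX, hY, hXY, htXY, hXv, hYv⟩ := hL.split h2
      have h1 := dw X hX
      have h2 := dw Y hY
      exact ⟨D₁, X, Y, D₂, D₃, by grind, ⟨⟨dc.1, hX.1, hY.1⟩, ⟨h1.1.symm, h2.1.symm, hXY⟩,
        (dn X hXv).symm, (dn Y hYv).symm, htXY⟩, h.tri, h1.2.1, h1.2.2, h2.2.1, h2.2.2⟩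
    · obtain ⟨A, B, C, rfl, hp, hAv, -⟩ := hL.spanning hc hv hv
      have h1 := dw A hp.1.1
      have h2 := dw B hp.1.2.1
      have h3 := dw C hp.1.2.2
      have h4 := dn A hAv
      obtain ⟨⟨hA, hB, hC⟩, ⟨dAB, dAC, dBC⟩, tAB, tAC, tBC⟩ := hp
      refine ⟨A ∪ D₁, B, C, D₂, D₃, by grind, ⟨⟨hA.1.union_touch dc.1 h4, hB.1, hC.1⟩,
        ⟨?_, ?_, dBC⟩, ?_, ?_, tBC⟩, ⟨⟨hA.1.union_touch dc.1 h4, dc.2⟩, ⟨?_, ?_, ds.2.2⟩,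
        ?_, ?_, dt.2.2⟩, h2.2.1, h2.2.2, h3.2.1, h3.2.2⟩
      · exact apart_union_left.2 ⟨dAB, h2.1.symm⟩
      · exact apart_union_left.2 ⟨dAC, h3.1.symm⟩
      · exact touch_union_left.2 (.inl tAB)
      · exact touch_union_left.2 (.inl tAC)
      · exact apart_union_left.2 ⟨h1.2.1, ds.1⟩
      · exact apart_union_left.2 ⟨h1.2.2, ds.2.1⟩
      · exact touch_union_left.2 (.inr dt.1)
      · exact touch_union_left.2 (.inr dt.2.1)
  · have := h.disj₁.mono_left hK.2
    have := h.disj₂.mono_left hK.2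
    have := h.disj₃.mono_left hK.2
    have : Disjoint K L := hd
    simp_all [Set.disjoint_union_right]

theorem Lobe.not_cyc_two_two [Finite V] (h : Lobe G v W D₁ D₂ D₃) {K L : Set V}
    (hK : Piece G W K) (hL : Piece G W L) (hd : Apart K L) (hc : Cyc G K) (hv : Touch G K {v})
    (h2 : TwoTouch G L {v} {v}) (hcr : 2 ≤ (crossing G K L).ncard) : False := by
  induction hn : L.ncard using Nat.strong_induction_on generalizing K L with
  | _ n ih =>
  have step : ∀ Y Z, L = Y ∪ Z → Piece G W Y → Piece G W Z → Apart Y Z → Touch G Y Z →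
      Touch G Y K → Touch G Z K → ¬ Touch G Z {v} → False := by
    rintro Y Z rfl hY hZ hYZ htYZ hYK hZK hZv
    simp only [apart_union_right] at hd
    refine ih Y.ncard ?_ (hK.union hZ hZK.symm) hY (apart_union_left.2 ⟨hd.1, hYZ.symm⟩)
      (hc.mono Set.subset_union_left) (hv.mono Set.subset_union_left subset_rfl) ?_ ?_ rfl
    · rw [← hn]
      refine Set.ncard_lt_ncard ?_ (Set.toFinite _)
      obtain ⟨z, hz⟩ := hZ.1.1
      exact ⟨Set.subset_union_left, fun hs => Set.disjoint_left.1 hYZ (hs (.inr hz)) hz⟩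
    · obtain ⟨a, ha, b, hb, hab, hav, hbv⟩ := h2
      exact ⟨a, ha.resolve_right fun h => hZv ⟨a, h, hav⟩, b,
        hb.resolve_right fun h => hZv ⟨b, h, hbv⟩, hab, hav, hbv⟩
    · rw [crossing_ncard_union_left hd.2]
      have := one_le_crossing hYK.symm
      have := one_le_crossing htYZ.symm
      omega
  by_cases hL2 : TwoTouch G L K K
  · obtain ⟨Y, Z, rfl, hY, hZ, hYZ, htYZ, hYK, hZK⟩ := hL.split hL2
    simp only [apart_union_right] at hd
    by_cases hYv : Touch G Y {v}
    · by_cases hZv : Touch G Z {v}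
      · exact h.not_cyc_both ⟨hK, hY, hZ⟩ ⟨hd.1, hd.2, hYZ⟩ hc ⟨hYv, hZv⟩
          ⟨htYZ, hYK.symm, hZK.symm⟩
      · exact step Y Z rfl hY hZ hYZ htYZ hYK hZK hZv
    · exact step Z Y (Set.union_comm _ _) hZ hY hYZ.symm htYZ.symm hZK hYK hYv
  · obtain ⟨a, ha, a', ha', hne, ⟨b, hb, hab⟩, b', hb', hab'⟩ :=
      (twoTouch_of_crossing hcr).resolve_right hL2
    obtain rfl : b = b' := by
      by_contra hne'
      exact hL2 ⟨b, hb, b', hb', hne', ⟨a, ha, hab.symm⟩, a', ha', hab'.symm⟩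
    obtain ⟨Y, Z, rfl, hY, hZ, hYZ, htYZ, hYv, hZv⟩ := hL.split h2
    simp only [apart_union_right] at hd
    rcases hb with hb | hb
    · exact h.not_cyc_two ⟨hK, hY, hZ⟩ ⟨hd.1, hd.2, hYZ⟩ hc ⟨hv, hYv, hZv⟩ htYZ
        ⟨a, ha, a', ha', hne, ⟨b, hb, hab⟩, b, hb, hab'⟩
    · exact h.not_cyc_two ⟨hK, hZ, hY⟩ ⟨hd.2, hd.1, hYZ.symm⟩ hc ⟨hv, hZv, hYv⟩ htYZ.symm
        ⟨a, ha, a', ha', hne, ⟨b, hb, hab⟩, b, hb, hab'⟩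

theorem Lobe.not_matching [Finite V] (h : Lobe G v W D₁ D₂ D₃) {K L : Set V}
    (hK : Piece G W K) (hL : Piece G W L) (hd : Apart K L) (hv : Touch G K {v})
    (hsplit : ∀ Y Z, L = Y ∪ Z → Piece G W Y → Piece G W Z → Apart Y Z → Touch G Y Z →
      Touch G Y K → Touch G Z K → Touch G Y {v} ∧ Touch G Z {v}) {p q r : V × V}
    (hp : p ∈ crossing G K L) (hq : q ∈ crossing G K L) (hr : r ∈ crossing G K L)
    (hpq : p.1 ≠ q.1 ∧ p.2 ≠ q.2) (hrp : r ≠ p) (hrq : r ≠ q) : False := by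
  have key : ∀ X X' Y Y', K = X ∪ X' → L = Y ∪ Y' → Piece G W X → Piece G W X' → Piece G W Y →
      Piece G W Y' → Apart X X' → Apart Y Y' → Touch G X X' → Touch G Y Y' → Touch G X Y →
      Touch G X' Y' → Touch G X' Y → False := by
    rintro X X' Y Y' rfl rfl hX hX' hY hY' dX dY tX tY tXY tXY' tXY''
    have hYv := hsplit Y Y' rfl hY hY' dY tY (by grind) (by grind)
    clear hsplit
    simp only [touch_union_left] at hv
    rcases hv with hv | hv
    · exact h.excl_O7 (A := X') (B := Y) (C := X) (E := Y')
    · exact h.excl_O8 (A := X') (B := Y) (C := Y') (E := X)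
  have key2 : ∀ X X' Y Y', K = X ∪ X' → L = Y ∪ Y' → Piece G W X → Piece G W X' → Piece G W Y →
      Piece G W Y' → Apart X X' → Apart Y Y' → Touch G X X' → Touch G Y Y' → Touch G X Y →
      Touch G X' Y' → TwoTouch G X Y Y ∨ TwoTouch G Y X X → False := by
    rintro X X' Y Y' hKX hLY hX hX' hY hY' dX dY tX tY tXY tXY' (h2 | h2)
    · clear tXY
      obtain ⟨U, U', rfl, hU, hU', dU, tU, hUY, hUY'⟩ := hX.split h2
      rcases touch_union_left.1 tX with tX | tX
      · exact key U' (U ∪ X') Y Y' (by grind) hLY hU' (by grind) hY hY' (by grind) dY (by grind) tY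
          hUY' (by grind) (by grind)
      · exact key U (U' ∪ X') Y Y' (by grind) hLY hU (by grind) hY hY' (by grind) dY (by grind) tY
          hUY (by grind) (by grind)
    · obtain ⟨U, U', rfl, hU, hU', dU, tU, hUY, hUY'⟩ := hY.split h2
      rcases touch_union_left.1 tY with tY | tY
      · exact key X' X (U ∪ Y') U' (by grind) (by grind) hX' hX (by grind) hU' dX.symm (by grind)
          tX.symm (by grind) (by grind) (by grind) (by grind)
      · exact key X' X (U' ∪ Y') U (by grind) (by grind) hX' hX (by grind) hU dX.symm (by grind)
          tX.symm (by grind) (by grind) (by grind) (by grind)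
  obtain ⟨X, X', hKX, dX, hpX, hqX, hX, hX', tX⟩ := hK.1.split hp.1 hq.1 hpq.1
  obtain ⟨Y, Y', hLY, dY, hpY, hqY, hY, hY', tY⟩ := hL.1.split hp.2.1 hq.2.1 hpq.2
  have hXs := hK.2
  have hYs := hL.2
  rw [hKX, Set.union_subset_iff] at hXs
  rw [hLY, Set.union_subset_iff] at hYs
  have t1 : Touch G X Y := ⟨_, hpX, _, hpY, hp.2.2⟩
  have t2 : Touch G X' Y' := ⟨_, hqX, _, hqY, hq.2.2⟩
  have two : ∀ {X Y : Set V} {p q : V × V}, p.1 ∈ X → p.2 ∈ Y → q.1 ∈ X → q.2 ∈ Y →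
      G.Adj p.1 p.2 → G.Adj q.1 q.2 → p ≠ q → TwoTouch G X Y Y ∨ TwoTouch G Y X X := by
    intro X Y p q h1 h2 h3 h4 h5 h6 hne
    by_cases h7 : p.1 = q.1
    · exact .inr ⟨_, h2, _, h4, fun h8 => hne (Prod.ext h7 h8), ⟨_, h1, h5.symm⟩, _, h3, h6.symm⟩
    · exact .inl ⟨_, h1, _, h3, h7, ⟨_, h2, h5⟩, _, h4, h6⟩
  have hr1 := hr.1
  have hr2 := hr.2.1
  rw [hKX] at hr1
  rw [hLY] at hr2
  rcases hr1 with hr1 | hr1 <;> rcases hr2 with hr2 | hr2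
  · exact key2 X X' Y Y' hKX hLY ⟨hX, hXs.1⟩ ⟨hX', hXs.2⟩ ⟨hY, hYs.1⟩ ⟨hY', hYs.2⟩ dX dY tX tY
      t1 t2 (two hr1 hr2 hpX hpY hr.2.2 hp.2.2 hrp)
  · exact key X' X Y' Y (by rw [hKX, Set.union_comm]) (by rw [hLY, Set.union_comm]) ⟨hX', hXs.2⟩
      ⟨hX, hXs.1⟩ ⟨hY', hYs.2⟩ ⟨hY, hYs.1⟩ dX.symm dY.symm tX.symm tY.symm t2 t1
      ⟨_, hr1, _, hr2, hr.2.2⟩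
  · exact key X X' Y Y' hKX hLY ⟨hX, hXs.1⟩ ⟨hX', hXs.2⟩ ⟨hY, hYs.1⟩ ⟨hY', hYs.2⟩ dX dY tX tY
      t1 t2 ⟨_, hr1, _, hr2, hr.2.2⟩
  · exact key2 X' X Y' Y (by rw [hKX, Set.union_comm]) (by rw [hLY, Set.union_comm]) ⟨hX', hXs.2⟩
      ⟨hX, hXs.1⟩ ⟨hY', hYs.2⟩ ⟨hY, hYs.1⟩ dX.symm dY.symm tX.symm tY.symm t2 t1
      (two hr1 hr2 hqX hqY hr.2.2 hq.2.2 hrq)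

end

theorem touch_of_twoTouch_union {X Y M : Set V} (h : TwoTouch G (X ∪ Y) M M) (hY : ¬ Touch G Y M) :
    TwoTouch G X M M := by
  obtain ⟨a, ha, b, hb, hab, hav, hbv⟩ := h
  exact ⟨a, ha.resolve_right fun h => hY ⟨a, h, hav⟩, b,
    hb.resolve_right fun h => hY ⟨b, h, hbv⟩, hab, hav, hbv⟩

theorem ncard_lt_union [Finite V] {Y Z : Set V} (h : Apart Y Z) (hZ : ConnSet G Z) :
    Y.ncard < (Y ∪ Z).ncard := by
  refine Set.ncard_lt_ncard ?_ (Set.toFinite _)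
  obtain ⟨z, hz⟩ := hZ.1
  exact ⟨Set.subset_union_left, fun hs => Set.disjoint_left.1 h (hs (.inr hz)) hz⟩

section

variable {v : V} {W D₁ D₂ D₃ : Set V}

theorem Lobe.not_two_two [Finite V] (h : Lobe G v W D₁ D₂ D₃) {K L : Set V}
    (hK : Piece G W K) (hL : Piece G W L) (hd : Apart K L) (ht : Touch G K L)
    (hKc : ¬ Cyc G K) (hLc : ¬ Cyc G L)
    (hK2 : TwoTouch G K {v} {v}) (hL2 : TwoTouch G L {v} {v}) (hrk : 4 ≤ rk G (K ∪ L)) :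
    False := by
  induction hn : L.ncard using Nat.strong_induction_on generalizing K L with
  | _ n ih =>
  have hcr : 3 ≤ (crossing G K L).ncard := by
    rw [rk_union hd] at hrk
    have := hK.1.rk_le_zero hKc
    have := hL.1.rk_le_zero hLc
    omega
  have step : ∀ Y Z, L = Y ∪ Z → Piece G W Y → Piece G W Z → Apart Y Z → Touch G Y Z →
      Touch G Y K → Touch G Z K → ¬ Touch G Z {v} → False := by
    rintro Y Z rfl hY hZ hYZ htYZ hYK hZK hZv
    simp only [apart_union_right] at hd
    have hd' : Apart (K ∪ Z) Y := apart_union_left.2 ⟨hd.1, hYZ.symm⟩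
    have hY2 := touch_of_twoTouch_union hL2 hZv
    have hKZ := hK.union hZ hZK.symm
    by_cases hc : Cyc G (K ∪ Z)
    · refine h.not_cyc_two_two hKZ hY hd' hc (hK2.touch.mono Set.subset_union_left subset_rfl)
        hY2 ?_
      rw [crossing_ncard_union_left hd.2]
      have := one_le_crossing hYK.symm
      have := one_le_crossing htYZ.symm
      omega
    · refine ih Y.ncard (hn ▸ ncard_lt_union hYZ hZ.1) hKZ hY hd'
        (hYK.symm.mono Set.subset_union_left subset_rfl) hc
        (fun h => hLc (h.mono Set.subset_union_left))
        (hK2.mono Set.subset_union_left subset_rfl subset_rfl) hY2 ?_ rfl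
      rwa [Set.union_assoc, Set.union_comm Z]
  have hsplit : ∀ Y Z, L = Y ∪ Z → Piece G W Y → Piece G W Z → Apart Y Z → Touch G Y Z →
      Touch G Y K → Touch G Z K → Touch G Y {v} ∧ Touch G Z {v} := by
    intro Y Z hYZ hY hZ d t hYK hZK
    constructor
    · by_contra hv
      exact step Z Y (by rw [hYZ, Set.union_comm]) hZ hY d.symm t.symm hZK hYK hv
    · by_contra hv
      exact step Y Z hYZ hY hZ d t hYK hZK hv
  obtain ⟨p, q, r, hp, hq, hr, hpq, hpr, hqr⟩ := exists_three_of_crossing hcr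
  by_cases h1 : p.1 ≠ q.1 ∧ p.2 ≠ q.2
  · exact h.not_matching hK hL hd hK2.touch hsplit hp hq hr h1 hpr.symm hqr.symm
  by_cases h2 : p.1 ≠ r.1 ∧ p.2 ≠ r.2
  · exact h.not_matching hK hL hd hK2.touch hsplit hp hr hq h2 hpq.symm hqr
  by_cases h3 : q.1 ≠ r.1 ∧ q.2 ≠ r.2
  · exact h.not_matching hK hL hd hK2.touch hsplit hq hr hp h3 hpq hpr
  have hfst : ∀ {p q : V × V}, p ≠ q → p.1 = q.1 → p.2 ≠ q.2 := fun h h1 h2 => h (Prod.ext h1 h2)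
  have hcase : (p.1 = q.1 ∧ p.1 = r.1) ∨ (p.2 = q.2 ∧ p.2 = r.2) := by
    have := hfst hpq; have := hfst hpr; have := hfst hqr
    grind
  rcases hcase with ⟨e1, e2⟩ | ⟨e1, e2⟩
  · obtain ⟨Y, Z, rfl, hY, hZ, dY, tY, hYv, hZv⟩ := hK.split hK2
    simp only [apart_union_left] at hd
    have key : ∀ Y Z, Piece G W Y → Piece G W Z → Apart Y Z → Touch G Y Z → Touch G Y {v} →
        Touch G Z {v} → Apart Y L → Apart Z L → p.1 ∈ Y → False := by
      intro Y Z hY hZ dY tY hYv hZv d1 d2 hpY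
      exact h.not_three ⟨hL, hY, hZ⟩ ⟨d1.symm, d2.symm, dY⟩ ⟨hYv, hZv⟩ tY hL2
        ⟨p.2, q.2, r.2, ⟨hp.2.1, hq.2.1, hr.2.1⟩, ⟨hfst hpq e1, hfst hpr e2,
          hfst hqr (e1.symm.trans e2)⟩, ⟨p.1, hpY, hp.2.2.symm⟩, ⟨p.1, hpY, e1 ▸ hq.2.2.symm⟩,
          ⟨p.1, hpY, e2 ▸ hr.2.2.symm⟩⟩
    rcases hp.1 with hpY | hpY
    · exact key Y Z hY hZ dY tY hYv hZv hd.1 hd.2 hpY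
    · exact key Z Y hZ hY dY.symm tY.symm hZv hYv hd.2 hd.1 hpY
  · obtain ⟨Y, Z, rfl, hY, hZ, dY, tY, hYv, hZv⟩ := hL.split hL2
    simp only [apart_union_right] at hd
    have key : ∀ Y Z, Piece G W Y → Piece G W Z → Apart Y Z → Touch G Y Z → Touch G Y {v} →
        Touch G Z {v} → Apart K Y → Apart K Z → p.2 ∈ Y → False := by
      intro Y Z hY hZ dY tY hYv hZv d1 d2 hpY
      exact h.not_three ⟨hK, hY, hZ⟩ ⟨d1, d2, dY⟩ ⟨hYv, hZv⟩ tY hK2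
        ⟨p.1, q.1, r.1, ⟨hp.1, hq.1, hr.1⟩, ⟨fun e => hfst hpq e e1, fun e => hfst hpr e e2,
          fun e => hfst hqr e (e1.symm.trans e2)⟩, ⟨p.2, hpY, hp.2.2⟩, ⟨p.2, hpY, e1 ▸ hq.2.2⟩,
          ⟨p.2, hpY, e2 ▸ hr.2.2⟩⟩
    rcases hp.2.1 with hpY | hpY
    · exact key Y Z hY hZ dY tY hYv hZv hd.1 hd.2 hpY
    · exact key Z Y hZ hY dY.symm tY.symm hZv hYv hd.2 hd.1 hpY

theorem Lobe.not_rich_rich [Finite V] (h : Lobe G v W D₁ D₂ D₃) (hrk : 4 ≤ rk G W) {K L : Set V}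
    (hKL : Halves G W K L) (hK : Rich G v K) (hL : Rich G v L) : False := by
  have key : ∀ K L, Halves G W K L → Rich G v K → Rich G v L → Cyc G K → ¬ Cyc G L → False := by
    intro K L ⟨hW, hpK, hpL, hd, ht⟩ hK hL hKc hLc
    have hL2 := hL.resolve_right fun h => hLc h.2
    refine h.not_cyc_two_two hpK hpL hd hKc hK.touch hL2 ?_
    have h1 := h.rk_le_two hpK hpL hd hL
    have h2 := hpL.1.rk_le_zero hLc
    rw [hW, rk_union hd] at hrk
    omega
  by_cases hKc : Cyc G K <;> by_cases hLc : Cyc G L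
  · exact h.not_cyc_cyc hKL.2.1 hKL.2.2.1 hKL.2.2.2.1 hKL.2.2.2.2 hKc hLc hK.touch hL.touch
  · exact key K L hKL hK hL hKc hLc
  · exact key L K hKL.symm hL hK hLc hKc
  · exact h.not_two_two hKL.2.1 hKL.2.2.1 hKL.2.2.2.1 hKL.2.2.2.2 hKc hLc
      (hK.resolve_right fun h => hKc h.2) (hL.resolve_right fun h => hLc h.2) (hKL.1 ▸ hrk)

theorem mem_of_three_mem_union {A B Z : Set V} {n₁ n₂ n₃ : V}
    (h : n₁ ∈ A ∪ B ∪ Z ∧ n₂ ∈ A ∪ B ∪ Z ∧ n₃ ∈ A ∪ B ∪ Z)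
    (hA : (n₁ ∈ A → n₂ ∉ A) ∧ (n₁ ∈ A → n₃ ∉ A) ∧ (n₂ ∈ A → n₃ ∉ A))
    (hB : (n₁ ∈ B → n₂ ∉ B) ∧ (n₁ ∈ B → n₃ ∉ B) ∧ (n₂ ∈ B → n₃ ∉ B)) :
    n₁ ∈ Z ∨ n₂ ∈ Z ∨ n₃ ∈ Z := by
  grind

theorem Lobe.not_three_neighbors [Finite V] (h : Lobe G v W D₁ D₂ D₃) (hrk : 4 ≤ rk G W)
    (hstar : ∀ x ∈ W, ∃ K ⊆ W, x ∉ K ∧ ConnSet G K ∧ Rich G v K) {n₁ n₂ n₃ : V}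
    (hn : n₁ ∈ W ∧ n₂ ∈ W ∧ n₃ ∈ W) (hne : n₁ ≠ n₂ ∧ n₁ ≠ n₃ ∧ n₂ ≠ n₃)
    (hv : G.Adj n₁ v ∧ G.Adj n₂ v ∧ G.Adj n₃ v) : False := by
  obtain ⟨X₀, Y₀, h₀, -, hR₀⟩ := exists_halves h.conn hstar hn.1
  obtain ⟨X, -, hX⟩ := Set.Finite.exists_le_minimal
    (Set.toFinite {X : Set V | ∃ Y, Halves G W X Y ∧ Rich G v X}) ⟨Y₀, h₀, hR₀⟩
  obtain ⟨Y, hXY, hR⟩ := hX.prop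
  have hmin : ∀ X' Y', Halves G W X' Y' → Rich G v X' → X' ⊆ X → X ⊆ X' :=
    fun X' Y' h1 h2 h3 => hX.le_of_le ⟨Y', h1, h2⟩ h3
  have hY : ¬ Rich G v Y := fun hY => h.not_rich_rich hrk hXY hR hY
  obtain ⟨hW, hpX, hpY, hd, a, ha, b, hb, hab⟩ := hXY
  by_cases h2 : TwoTouch G X Y Y
  · obtain ⟨X₁, X₂, rfl, hp1, hp2, d, t, t1, t2⟩ := hpX.split h2
    have hd' := apart_union_left.1 hd
    have hX1 : ¬ Rich G v X₁ := fun hr => by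
      obtain ⟨x, hx⟩ := hp2.1.1
      have := hmin X₁ (X₂ ∪ Y) ⟨by rw [hW, Set.union_assoc], hp1, hp2.union hpY t2,
        apart_union_right.2 ⟨d, hd'.1⟩, touch_union_right.2 (.inl t)⟩ hr Set.subset_union_left
      exact Set.disjoint_left.1 d (this (.inr hx)) hx
    have hX2 : ¬ Rich G v X₂ := fun hr => by
      obtain ⟨x, hx⟩ := hp1.1.1
      have := hmin X₂ (X₁ ∪ Y) ⟨by rw [hW, Set.union_comm X₁, Set.union_assoc], hp2,
        hp1.union hpY t1, apart_union_right.2 ⟨d.symm, hd'.2⟩, touch_union_right.2 (.inl t.symm)⟩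
        hr Set.subset_union_right
      exact Set.disjoint_left.1 d hx (this (.inl hx))
    have two : ∀ Z, ¬ Rich G v Z → ∀ n n', n ≠ n' → G.Adj n v → G.Adj n' v → n ∈ Z → n' ∉ Z :=
      fun Z hZ n n' h1 h2 h3 h4 h5 => hZ (.inl ⟨n, h4, n', h5, h1, ⟨v, rfl, h2⟩, v, rfl, h3⟩)
    have tv : Touch G X₁ {v} ∧ Touch G X₂ {v} ∧ Touch G Y {v} := by
      have ht : ∀ {Z : Set V}, (n₁ ∈ Z ∨ n₂ ∈ Z ∨ n₃ ∈ Z) → Touch G Z {v} := by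
        rintro Z (h | h | h)
        exacts [⟨_, h, v, rfl, hv.1⟩, ⟨_, h, v, rfl, hv.2.1⟩, ⟨_, h, v, rfl, hv.2.2⟩]
      have e : ∀ Z, ¬ Rich G v Z →
          (n₁ ∈ Z → n₂ ∉ Z) ∧ (n₁ ∈ Z → n₃ ∉ Z) ∧ (n₂ ∈ Z → n₃ ∉ Z) := fun Z hZ =>
        ⟨two Z hZ n₁ n₂ hne.1 hv.1 hv.2.1, two Z hZ n₁ n₃ hne.2.1 hv.1 hv.2.2,
          two Z hZ n₂ n₃ hne.2.2 hv.2.1 hv.2.2⟩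
      rw [hW] at hn
      refine ⟨ht (mem_of_three_mem_union ?_ (e X₂ hX2) (e Y hY)),
        ht (mem_of_three_mem_union ?_ (e X₁ hX1) (e Y hY)),
        ht (mem_of_three_mem_union hn (e X₁ hX1) (e X₂ hX2))⟩
      · rwa [Set.union_assoc, Set.union_comm] at hn
      · rwa [Set.union_right_comm] at hn
    have r1 := hp1.1.rk_le_zero fun hc => hX1 (.inr ⟨tv.1, hc⟩)
    have r2 := hp2.1.rk_le_zero fun hc => hX2 (.inr ⟨tv.2.1, hc⟩)
    have r3 := hpY.1.rk_le_zero fun hc => hY (.inr ⟨tv.2.2, hc⟩)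
    rw [hW, rk_union hd, rk_union d, crossing_ncard_union_left d] at hrk
    push_cast at hrk
    have hcr : 2 ≤ (crossing G X₁ X₂).ncard ∨ 2 ≤ (crossing G X₁ Y).ncard ∨
        2 ≤ (crossing G X₂ Y).ncard := by omega
    rcases hcr with hcr | hcr | hcr <;> rcases twoTouch_of_crossing hcr with h2 | h2
    · exact h.not_cluster ⟨hp1, hp2, hpY⟩ ⟨d, hd'⟩ tv ⟨t, t1, t2⟩ h2
    · exact h.not_cluster ⟨hp2, hp1, hpY⟩ ⟨d.symm, hd'.symm⟩ ⟨tv.2.1, tv.1, tv.2.2⟩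
        ⟨t.symm, t2, t1⟩ h2
    · exact h.not_cluster ⟨hp1, hpY, hp2⟩ ⟨hd'.1, d, hd'.2.symm⟩ ⟨tv.1, tv.2.2, tv.2.1⟩
        ⟨t1, t, t2.symm⟩ h2
    · exact h.not_cluster ⟨hpY, hp1, hp2⟩ ⟨hd'.1.symm, hd'.2.symm, d⟩ ⟨tv.2.2, tv.1, tv.2.1⟩
        ⟨t1.symm, t2.symm, t⟩ h2
    · exact h.not_cluster ⟨hp2, hpY, hp1⟩ ⟨hd'.2, d.symm, hd'.1.symm⟩ ⟨tv.2.1, tv.2.2, tv.1⟩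
        ⟨t2, t.symm, t1.symm⟩ h2
    · exact h.not_cluster ⟨hpY, hp2, hp1⟩ ⟨hd'.2.symm, hd'.1.symm, d.symm⟩ ⟨tv.2.2, tv.2.1, tv.1⟩
        ⟨t2.symm, t1.symm, t.symm⟩ h2
  · have hun : ∀ x ∈ X, ∀ y ∈ Y, G.Adj x y → x = a := by
      intro x hx y hy hxy
      by_contra hne
      exact h2 ⟨x, hx, a, ha, hne, ⟨y, hy, hxy⟩, b, hb, hab⟩
    obtain ⟨X', Y', hXY', haY', hR'⟩ := exists_halves h.conn hstar (hpX.2 ha)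
    have haX' : a ∉ X' := fun h => Set.disjoint_left.1 hXY'.2.2.2.1 h haY'
    rcases hXY'.2.1.1.subset_or_subset (hW ▸ hXY'.2.1.2) haX' hun with hs | hs
    · exact haX' (hmin X' Y' hXY' hR' hs ha)
    · exact hY (hR'.mono hs)

theorem Piece.cyc_union [Finite V] {W A B : Set V} (hA : Piece G W A) (hB : Piece G W B)
    (hd : Apart A B) (h : TwoTouch G B A A) : Cyc G (A ∪ B) := by
  obtain ⟨X, Y, rfl, hX, hY, d, t, tX, tY⟩ := hB.split h
  have hd' := apart_union_right.1 hd
  exact ⟨A, X, Y, by rw [Set.union_assoc], ⟨hA.1, hX.1, hY.1⟩, ⟨hd'.1, hd'.2, d⟩, tX.symm,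
    tY.symm, t⟩

theorem Lobe.not_two_neighbors [Finite V] (h : Lobe G v W D₁ D₂ D₃)
    (hstar : ∀ x ∈ W, ∃ K ⊆ W, x ∉ K ∧ ConnSet G K ∧ Rich G v K) {n₁ n₂ : V}
    (hn : n₁ ∈ W) (hN : ∀ x ∈ W, G.Adj x v → x = n₁ ∨ x = n₂) (hv : G.Adj n₁ v) : False := by
  have tv : ∀ Z, n₁ ∈ Z → Touch G Z {v} := fun Z h => ⟨n₁, h, v, rfl, hv⟩
  have only : ∀ A B, Apart A B → A ⊆ W → B ⊆ W → Touch G B {v} → ¬ TwoTouch G A {v} {v} := by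
    rintro A B hd hA hB ⟨c, hc, x, hx, hcv⟩ ⟨a, ha, b, hb, hne, ⟨y, hy, hav⟩, z, hz, hbv⟩
    rw [Set.mem_singleton_iff] at hx hy hz
    subst x y z
    have h1 := hN a (hA ha) hav
    have h2 := hN b (hA hb) hbv
    have h3 := hN c (hB hc) hcv
    have h4 := Set.disjoint_left.1 hd ha
    have h5 := Set.disjoint_left.1 hd hb
    grind
  have only3 : ∀ A B C, Apart A B → Apart A C → Apart B C → A ⊆ W → B ⊆ W → C ⊆ W →
      Touch G A {v} → Touch G B {v} → ¬ Touch G C {v} := by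
    rintro A B C h1 h2 h3 hA hB hC ⟨a, ha, x, hx, hav⟩ ⟨b, hb, y, hy, hbv⟩ ⟨c, hc, z, hz, hcv⟩
    rw [Set.mem_singleton_iff] at hx hy hz
    subst x y z
    have h1 := Set.disjoint_left.1 h1 ha
    have h2 := Set.disjoint_left.1 h2 ha
    have h3 := Set.disjoint_left.1 h3 hb
    have := hN a (hA ha) hav
    have := hN b (hB hb) hbv
    have := hN c (hC hc) hcv
    grind
  have good : ∀ X Y, Halves G W X Y → Rich G v X → Touch G Y {v} → Cyc G X := by
    intro X Y hXY hR hY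
    exact (hR.resolve_left (only X Y hXY.2.2.2.1 hXY.2.1.2 hXY.2.2.1.2 hY)).2
  obtain ⟨Q₀, P₀, h₀, hn₀, hR₀⟩ := exists_halves h.conn hstar hn
  obtain ⟨Q, -, hQmin⟩ := Set.Finite.exists_le_minimal
    (Set.toFinite {Q : Set V | ∃ P, Halves G W Q P ∧ Touch G Q {v} ∧ Touch G P {v} ∧ Cyc G Q})
    ⟨P₀, h₀, hR₀.touch, tv P₀ hn₀, good Q₀ P₀ h₀ hR₀ (tv P₀ hn₀)⟩
  obtain ⟨P, hQP, hQv, hPv, hQc⟩ := hQmin.prop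
  have hmin : ∀ Q' P', Halves G W Q' P' → Touch G Q' {v} → Touch G P' {v} → Cyc G Q' → Q' ⊆ Q →
      Q ⊆ Q' := fun Q' P' h1 h2 h3 h4 h5 => hQmin.le_of_le ⟨P', h1, h2, h3, h4⟩ h5
  obtain ⟨hW, hQ, hP, dQP, tQP⟩ := id hQP
  have hPc : ¬ Cyc G P := fun hc => h.not_cyc_cyc hQ hP dQP tQP hQc hc hQv hPv
  have touch_other : ∀ X Y, Halves G W X Y → (X ⊆ Q ∨ X ⊆ P) → Rich G v X → Touch G Y {v} := by
    intro X Y hXY hs hR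
    obtain ⟨c, hc, hcv⟩ := hQv
    obtain ⟨b, hb, hbv⟩ := hPv
    have hcW := hQ.2 hc
    have hbW := hP.2 hb
    rw [hXY.1] at hcW hbW
    have : c ∈ Y ∨ b ∈ Y := by
      rcases hs with hs | hs
      · exact .inr (hbW.resolve_left fun h => Set.disjoint_left.1 dQP (hs h) hb)
      · exact .inl (hcW.resolve_left fun h => Set.disjoint_left.1 dQP hc (hs h))
    rcases this with h | h
    · exact ⟨c, h, hcv⟩
    · exact ⟨b, h, hbv⟩
  have hQ2 : TwoTouch G Q P P := by
    by_contra hcon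
    obtain ⟨a, ha, b, hb, hab⟩ := tQP
    have hun : ∀ x ∈ Q, ∀ y ∈ P, G.Adj x y → x = a := by
      intro x hx y hy hxy
      by_contra hne
      exact hcon ⟨x, hx, a, ha, hne, ⟨y, hy, hxy⟩, b, hb, hab⟩
    obtain ⟨X', Y', hXY', haY', hR'⟩ := exists_halves h.conn hstar (hQ.2 ha)
    have haX' : a ∉ X' := fun h => Set.disjoint_left.1 hXY'.2.2.2.1 h haY'
    have hs := hXY'.2.1.1.subset_or_subset (hW ▸ hXY'.2.1.2) haX' hun
    have hYv := touch_other X' Y' hXY' hs hR'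
    have hc := good X' Y' hXY' hR' hYv
    rcases hs with hs | hs
    · exact haX' (hmin X' Y' hXY' hR'.touch hYv hc hs ha)
    · exact hPc (hc.mono hs)
  have hne : ∃ Y₁, ∃ Y₂, Halves G Q Y₁ Y₂ ∧ Touch G Y₁ P ∧ Touch G Y₂ P ∧ Touch G Y₁ {v} := by
    have hQ' : Piece G Q Q := ⟨hQ.1, subset_rfl⟩
    obtain ⟨Y₁, Y₂, rfl, h1, h2, d, t, t1, t2⟩ := hQ'.split hQ2
    rcases touch_union_left.1 hQv with hv' | hv'
    · exact ⟨Y₁, Y₂, ⟨rfl, h1, h2, d, t⟩, t1, t2, hv'⟩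
    · exact ⟨Y₂, Y₁, ⟨Set.union_comm _ _, h2, h1, d.symm, t.symm⟩, t2, t1, hv'⟩
  obtain ⟨Y₀, hY₀⟩ := hne
  obtain ⟨Y₁, -, hYmin⟩ := Set.Finite.exists_le_minimal (Set.toFinite {Y₁ : Set V |
    ∃ Y₂, Halves G Q Y₁ Y₂ ∧ Touch G Y₁ P ∧ Touch G Y₂ P ∧ Touch G Y₁ {v}}) hY₀
  obtain ⟨Y₂, ⟨hQY, hp1, hp2, d, t⟩, t1, t2, h1v⟩ := hYmin.prop
  replace hp1 : Piece G W Y₁ := ⟨hp1.1, hp1.2.trans hQ.2⟩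
  replace hp2 : Piece G W Y₂ := ⟨hp2.1, hp2.2.trans hQ.2⟩
  have hminY : ∀ Y₁' Y₂', Q = Y₁' ∪ Y₂' → Piece G W Y₁' → Piece G W Y₂' → Apart Y₁' Y₂' →
      Touch G Y₁' Y₂' → Touch G Y₁' P → Touch G Y₂' P → Touch G Y₁' {v} → Y₁' ⊆ Y₁ →
      Y₁ ⊆ Y₁' := by
    intro A B hAB hA hB h1 h2 h3 h4 h5 h6
    exact hYmin.le_of_le ⟨B, ⟨hAB, ⟨hA.1, by rw [hAB]; exact Set.subset_union_left⟩,
      ⟨hB.1, by rw [hAB]; exact Set.subset_union_right⟩, h1, h2⟩, h3, h4, h5⟩ h6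
  obtain ⟨d1, d2⟩ : Apart Y₁ P ∧ Apart Y₂ P := apart_union_left.1 (hQY ▸ dQP)
  have hWY : W = Y₁ ∪ (P ∪ Y₂) := by rw [hW, hQY, Set.union_assoc, Set.union_comm P]
  have hY1c : ¬ Cyc G Y₁ := fun hc => by
    have := hmin Y₁ (P ∪ Y₂) ⟨hWY, hp1, hP.union hp2 t2.symm, apart_union_right.2 ⟨d1, d⟩,
      touch_union_right.2 (.inl t1)⟩ h1v (touch_union_left.2 (.inl hPv)) hc
      (by rw [hQY]; exact Set.subset_union_left)
    obtain ⟨y, hy⟩ := hp2.1.1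
    exact Set.disjoint_left.1 d (this (hQY ▸ .inr hy)) hy
  have hY2c : ¬ Cyc G Y₂ := fun hc =>
    h.not_cyc_both ⟨hp2, hP, hp1⟩ ⟨d2, d.symm, d1.symm⟩ hc ⟨hPv, h1v⟩ ⟨t1.symm, t2, t.symm⟩
  have hcr : 2 ≤ (crossing G Y₁ Y₂).ncard := by
    have h1 := hp1.1.rk_le_zero hY1c
    have h2 := hp2.1.rk_le_zero hY2c
    have h3 := hQc.two_le_rk hQ.1
    rw [hQY, rk_union d] at h3
    omega
  have hY12 : ¬ TwoTouch G Y₁ Y₂ Y₂ := by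
    intro h2
    obtain ⟨U, U', hUU, hU, hU', dU, tU, tU1, tU2⟩ := hp1.split h2
    have key : ∀ U U', Y₁ = U ∪ U' → Piece G W U → Piece G W U' → Apart U U' → Touch G U U' →
        Touch G U Y₂ → Touch G U' Y₂ → Touch G U {v} → False := by
      intro U U' hUU hU hU' dU tU tU1 tU2 hUv
      rw [hUU, apart_union_left] at d d1
      rw [hUU, touch_union_left] at t1
      by_cases hPU : Touch G P U'
      · clear hQY hminY hWY hY1c hmin hYmin only only3 touch_other good hstar hQmin
        exact h.excl_O7 (A := U') (B := Y₂) (C := U) (E := P)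
      · obtain ⟨y, hy⟩ := hU'.1.1
        have := hminY U (U' ∪ Y₂) (by rw [hQY, hUU, Set.union_assoc]) hU (hU'.union hp2 tU2)
          (apart_union_right.2 ⟨dU, d.1⟩) (touch_union_right.2 (.inl tU))
          (t1.resolve_right fun h => hPU h.symm) (touch_union_left.2 (.inr t2)) hUv
          (by rw [hUU]; exact Set.subset_union_left)
        exact Set.disjoint_left.1 dU (this (hUU ▸ .inr hy)) hy
    rcases touch_union_left.1 (hUU ▸ h1v) with hv' | hv'
    · exact key U U' hUU hU hU' dU tU tU1 tU2 hv'
    · exact key U' U (by rw [hUU, Set.union_comm]) hU' hU dU.symm tU.symm tU2 tU1 hv'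
  have hY21 := (twoTouch_of_crossing hcr).resolve_left hY12
  obtain ⟨y₀, hy₀, w, hw, hyw⟩ := id t
  have hun : ∀ x ∈ Y₁, ∀ y ∈ Y₂, G.Adj x y → x = y₀ := by
    intro x hx y hy hxy
    by_contra hne
    exact hY12 ⟨x, hx, y₀, hy₀, hne, ⟨y, hy, hxy⟩, w, hw, hyw⟩
  have hun' : ∀ x ∈ Y₁, ∀ y ∈ P, G.Adj x y → x = y₀ := by
    intro x hx y hy hxy
    by_contra hne
    obtain ⟨J, J', hJ, dJ, hxJ, hyJ, hcJ, hcJ', tJ⟩ := hp1.1.split hx hy₀ hne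
    replace hcJ : Piece G W J :=
      ⟨hcJ, Set.subset_union_left.trans ((subset_of_eq hJ.symm).trans hp1.2)⟩
    replace hcJ' : Piece G W J' :=
      ⟨hcJ', Set.subset_union_right.trans ((subset_of_eq hJ.symm).trans hp1.2)⟩
    replace dJ : Apart J J' := dJ
    have tJP : Touch G J P := ⟨x, hxJ, y, hy, hxy⟩
    have tJY : Touch G J' Y₂ := ⟨y₀, hyJ, w, hw, hyw⟩
    have two : TwoTouch G Y₂ J' J' := by
      obtain ⟨b, hb, b', hb', hbb, ⟨c, hc, hbc⟩, c', hc', hbc'⟩ := hY21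
      obtain rfl := hun c hc b hb hbc.symm
      obtain rfl := hun c' hc' b' hb' hbc'.symm
      exact ⟨b, hb, b', hb', hbb, ⟨c', hyJ, hbc⟩, c', hyJ, hbc'⟩
    rw [hJ, apart_union_left] at d d1
    have hcyc := hcJ'.cyc_union hp2 d.2 two
    have dJP : Apart (J' ∪ Y₂) P := apart_union_left.2 ⟨d1.2, d2⟩
    have dJJ : Apart (J' ∪ Y₂) J := apart_union_left.2 ⟨dJ.symm, d.1.symm⟩
    have tJJ : Touch G (J' ∪ Y₂) P := touch_union_left.2 (.inr t2)
    rw [hJ, touch_union_left] at h1v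
    rcases h1v with h1v | h1v
    · exact h.not_cyc_both ⟨hcJ'.union hp2 tJY, hP, hcJ⟩ ⟨dJP, dJJ, d1.1.symm⟩ hcyc
        ⟨hPv, h1v⟩ ⟨tJP.symm, tJJ, touch_union_left.2 (.inl tJ.symm)⟩
    · have hWJ : W = J' ∪ Y₂ ∪ (P ∪ J) := by
        rw [hWY, hJ]
        clear * -
        grind
      have := hmin (J' ∪ Y₂) (P ∪ J) ⟨hWJ, hcJ'.union hp2 tJY, hP.union hcJ tJP.symm,
        apart_union_right.2 ⟨dJP, dJJ⟩, touch_union_right.2 (.inl tJJ)⟩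
        (touch_union_left.2 (.inl h1v)) (touch_union_left.2 (.inl hPv)) hcyc
        (by rw [hQY, hJ]; exact Set.union_subset_union_left _ Set.subset_union_right)
      rw [hQY, hJ] at this
      rcases this (.inl (.inl hxJ)) with hx' | hx'
      · exact Set.disjoint_left.1 dJ hxJ hx'
      · exact Set.disjoint_left.1 d.1 hxJ hx'
  have hM : Cyc G (P ∪ Y₂) := by
    obtain ⟨X, Y, hXY, hyY, hR⟩ := exists_halves h.conn hstar (hp1.2 hy₀)
    have hyX : y₀ ∉ X := fun h => Set.disjoint_left.1 hXY.2.2.2.1 h hyY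
    have hun2 : ∀ x ∈ Y₁, ∀ y ∈ P ∪ Y₂, G.Adj x y → x = y₀ := by
      rintro x hx y (hy | hy) hxy
      · exact hun' x hx y hy hxy
      · exact hun x hx y hy hxy
    rcases hXY.2.1.1.subset_or_subset (hWY ▸ hXY.2.1.2) hyX hun2 with hs | hs
    · have hs' : X ⊆ Q := hs.trans (by rw [hQY]; exact Set.subset_union_left)
      exact absurd ((good X Y hXY hR (touch_other X Y hXY (.inl hs') hR)).mono hs) hY1c
    · refine (hR.resolve_left ?_).2.mono hs
      exact only X Y₁ (Set.disjoint_of_subset_left hs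
        (apart_union_left.2 ⟨d1.symm, d.symm⟩)) hXY.2.1.2 hp1.2 h1v
  have hcr2 : 2 ≤ (crossing G P Y₂).ncard := by
    have h1 := hP.1.rk_le_zero hPc
    have h2 := hp2.1.rk_le_zero hY2c
    have h3 := hM.two_le_rk (hP.union hp2 t2.symm).1
    rw [rk_union d2.symm] at h3
    omega
  obtain ⟨U, U', rfl, hU, hU', dU, tU, tU1, tU2⟩ := hp2.split hY21
  clear hQY hminY hWY hY1c hmin hYmin only only3 touch_other good hstar hQmin hM hun hun' hw hY12
    hY21 hcr tQP hQ2 dQP hQv hQP hQc hY₀ h₀ hn₀ hR₀ hN tv hy₀ hW hQ hp2 hPc hY2c hn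
  have key : ∀ U U', Piece G W U → Piece G W U' → Apart U U' → Touch G U U' → Apart Y₁ U →
      Apart Y₁ U' → Apart U P → Apart U' P → Touch G U Y₁ → Touch G U' Y₁ →
      TwoTouch G P (U ∪ U') (U ∪ U') ∨ TwoTouch G (U ∪ U') P P → Touch G U P → False := by
    clear hcr2 t t2 d d2 hU hU' dU tU tU1 tU2 U U'
    intro U U' hU hU' dU tU d1U d1U' dUP dUP' tU1 tU1' h2 tUP
    by_cases tUP' : Touch G U' P
    · exact h.excl_O7 (A := U) (B := U') (C := P) (E := Y₁)
    · rcases h2 with h2 | h2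
      · obtain ⟨F, F', rfl, hF, hF', dF, tF, tFU, tFU'⟩ := hP.split h2
        have key : ∀ F F', Piece G W F → Piece G W F' → Apart F F' → Touch G F F' → Apart U F →
            Apart U' F → Apart U F' → Apart U' F' → Apart Y₁ F → Apart Y₁ F' → Touch G F U →
            Touch G F' U → Touch G F {v} → Touch G Y₁ F ∨ Touch G Y₁ F' → False := by
          clear tFU tFU' h2 hP
          intro F F' _ _ _ _ _ _ _ _ _ _ _ _ _ hor
          by_cases hYF : Touch G Y₁ F'
          · exact h.excl_O7 (A := U) (B := F') (C := F) (E := Y₁)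
          · exact h.excl_O6 (P := F) (Q := Y₁) (F := U) (S := F') (T := U')
        clear h2
        have := key F F' hF hF' dF tF
        have := key F' F hF' hF dF.symm tF.symm
        clear key
        grind
      · obtain ⟨F, F', rfl, hF, hF', dF, tF, tFU, tFU'⟩ :=
          hU.split (touch_of_twoTouch_union h2 tUP')
        have key : ∀ F F', Piece G W F → Piece G W F' → Apart F F' → Touch G F F' → Apart P F →
            Apart U' F → Apart P F' → Apart U' F' → Apart Y₁ F → Apart Y₁ F' → Touch G F P →
            Touch G F' P → Touch G Y₁ F → Touch G U' F ∨ Touch G U' F' → False := by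
          clear tFU tFU' h2 tU1 tU hU
          intro F F' _ _ _ _ _ _ _ _ _ _ _ _ _ hor
          by_cases hYF : Touch G U' F
          · exact h.excl_O6 (P := P) (Q := Y₁) (F := F) (S := F') (T := U')
          · exact h.excl_O7 (A := F) (B := F' ∪ U') (C := P) (E := Y₁)
        clear h2
        have := key F F' hF hF' dF tF
        have := key F' F hF' hF dF.symm tF.symm
        clear key
        grind
  have h2 := twoTouch_of_crossing hcr2
  rw [apart_union_right] at d
  rw [apart_union_left] at d2
  rcases touch_union_left.1 t2 with hUP | hUP
  · exact key U U' hU hU' dU tU d.1 d.2 d2.1 d2.2 tU1 tU2 h2 hUP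
  · exact key U' U hU' hU dU.symm tU.symm d.2 d.1 d2.2 d2.1 tU2 tU1
      (Set.union_comm U U' ▸ h2) hUP

/-- A lobe of rank at least two, every vertex of which is avoided by a rich set, does not
exist. -/
theorem Lobe.elim [Finite V] (h : Lobe G v W D₁ D₂ D₃) (hrk : 4 ≤ rk G W)
    (hstar : ∀ x ∈ W, ∃ K ⊆ W, x ∉ K ∧ ConnSet G K ∧ Rich G v K) : False := by
  obtain ⟨x, hx⟩ := h.conn.1
  obtain ⟨K, hKW, -, -, hR⟩ := hstar x hx
  obtain ⟨p, hp, x, hx, hpv⟩ := hR.touch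
  obtain rfl : v = x := hx.symm
  obtain ⟨L, hLW, hpL, -, hR'⟩ := hstar p (hKW hp)
  obtain ⟨q, hq, y, hy, hqv⟩ := hR'.touch
  obtain rfl : v = y := hy.symm
  by_cases hN : ∀ x ∈ W, G.Adj x v → x = p ∨ x = q
  · exact h.not_two_neighbors hstar (hKW hp) hN hpv
  · push Not at hN
    obtain ⟨r, hr, hrv, hrp, hrq⟩ := hN
    exact h.not_three_neighbors hrk hstar ⟨hKW hp, hLW hq, hr⟩
      ⟨fun h => hpL (h ▸ hq), hrp.symm, hrq.symm⟩ ⟨hpv, hqv, hrv⟩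

end

theorem ConnSet.exists_path {S : Set V} (hS : ConnSet G S) {a b : V} (ha : a ∈ S) (hb : b ∈ S) :
    ∃ p : G.Walk a b, p.IsPath ∧ ∀ x ∈ p.support, x ∈ S := by
  classical
  obtain ⟨p⟩ := (connSet_iff.1 hS).preconnected ⟨a, ha⟩ ⟨b, hb⟩
  let q := p.map (SimpleGraph.Embedding.induce S).toHom
  have hq : ∀ x ∈ q.support, x ∈ S := by
    intro x hx
    rw [Walk.support_map, List.mem_map] at hx
    obtain ⟨y, -, rfl⟩ := hx
    exact y.2
  exact ⟨q.bypass, q.bypass_isPath, fun x hx => hq x (q.support_bypass_subset_support hx)⟩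

theorem isPath_append {a b c : V} {p : G.Walk a b} {q : G.Walk b c} (hp : p.IsPath)
    (hq : q.IsPath) (h : ∀ x ∈ p.support, x ∈ q.support → x = b) : (p.append q).IsPath := by
  have hb : b ∉ q.support.tail := by
    have := hq.support_nodup
    rw [← Walk.cons_tail_support, List.nodup_cons] at this
    exact this.1
  refine Walk.IsPath.mk' ?_
  rw [Walk.support_append, List.nodup_append']
  refine ⟨hp.support_nodup, hq.support_nodup.tail, fun x hx hx' => hb ?_⟩
  exact h x hx (List.mem_of_mem_tail hx') ▸ hx'

theorem exists_last_path (M : Set V) {a b : V} (p : G.Walk a b) (hp : p.IsPath)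
    (h : ∃ x ∈ p.support, x ∈ M) : ∃ z ∈ M, ∃ q : G.Walk z b, q.IsPath ∧
      (∀ x ∈ q.support, x ∈ p.support) ∧ ∀ x ∈ q.support, x ∈ M → x = z := by
  induction p with
  | nil =>
    obtain ⟨x, hx, hM⟩ := h
    rw [Walk.support_nil, List.mem_singleton] at hx
    subst hx
    exact ⟨_, hM, Walk.nil, hp, by simp, by simp⟩
  | @cons u v w hadj p ih =>
    by_cases h' : ∃ x ∈ p.support, x ∈ M
    · obtain ⟨z, hz, q, hq, hs, hl⟩ := ih hp.of_cons h'
      exact ⟨z, hz, q, hq, fun x hx => by simp [hs x hx], hl⟩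
    · push Not at h'
      obtain ⟨x, hx, hM⟩ := h
      rw [Walk.support_cons, List.mem_cons] at hx
      obtain rfl := hx.resolve_right fun hx => h' x hx hM
      refine ⟨x, hM, Walk.cons hadj p, hp, fun _ => id, fun y hy hyM => ?_⟩
      rw [Walk.support_cons, List.mem_cons] at hy
      exact hy.resolve_right fun hy => h' y hy hyM

/-- There are two internally disjoint paths from `u` to `w`. -/
def Linked (G : SimpleGraph V) (u w : V) : Prop :=
  ∃ p q : G.Walk u w, p ≠ q ∧ p.IsPath ∧ q.IsPath ∧
    ∀ x ∈ p.support, x ∈ q.support → x = u ∨ x = w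

theorem Linked.of_adj {u w w' : V} (hw : ConnSet G {w}ᶜ) (h : Linked G u w) (huw : u ≠ w)
    (hadj : G.Adj w w') (hu : w' ≠ u) : Linked G u w' := by
  classical
  obtain ⟨p, q, hne, hp, hq, hpq⟩ := h
  obtain ⟨r, hr, hrw⟩ := hw.exists_path (a := u) (b := w') (by simpa using huw)
    (by simpa using hadj.ne')
  obtain ⟨z, hz, s, hs, hsr, hl⟩ := exists_last_path {x | x ∈ p.support ∨ x ∈ q.support} r hr
    ⟨u, by simp, by simp⟩
  have key : ∀ p q : G.Walk u w, p.IsPath → q.IsPath →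
      (∀ x ∈ p.support, x ∈ q.support → x = u ∨ x = w) →
      (∀ x ∈ s.support, x ∈ p.support ∨ x ∈ q.support → x = z) → z ∈ p.support →
      Linked G u w' := by
    intro p q hp hq hpq hl hz
    have hws : w ∉ s.support := fun h => hrw w (hsr w h) rfl
    have hzw : z ≠ w := fun h => hws (h ▸ s.start_mem_support)
    have hw'q : w' ∉ q.support := fun h => by
      have := hl w' s.end_mem_support (.inr h)
      subst this
      rcases hpq w' hz h with h | h
      · exact hu h
      · exact hzw h
    have hwt : w ∉ (p.takeUntil z hz).support :=
      Walk.endpoint_notMem_support_takeUntil hp hz hzw.symm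
    have hwa : w ∉ ((p.takeUntil z hz).append s).support := by
      rw [Walk.mem_support_append_iff]
      tauto
    refine ⟨(p.takeUntil z hz).append s, q.concat hadj, fun h => hwa ?_, ?_,
      hq.concat hw'q hadj, fun x hx hx' => ?_⟩
    · rw [h, Walk.support_concat]
      simp
    · exact isPath_append (hp.takeUntil hz) hs fun x hx hx' =>
        hl x hx' (.inl (Walk.support_takeUntil_subset_support _ _ hx))
    · rw [Walk.support_concat, List.mem_append, List.mem_singleton] at hx'
      rw [Walk.mem_support_append_iff] at hx
      rcases hx' with hx' | hx'
      · left
        rcases hx with hx | hx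
        · exact (hpq x (Walk.support_takeUntil_subset_support _ _ hx) hx').resolve_right
            fun h => hwt (h ▸ hx)
        · have := hl x hx (.inr hx')
          subst this
          exact (hpq x hz hx').resolve_right hzw
      · exact .inr hx'
  rcases hz with hz | hz
  · exact key p q hp hq hpq hl hz
  · exact key q p hq hp (fun x h1 h2 => hpq x h2 h1) (fun x h1 h2 => hl x h1 h2.symm) hz

/-- A graph without cut vertices and of minimum degree at least two is biconnected. -/
theorem kConnected_two (h2 : ∀ u : V, ∃ x y, x ≠ y ∧ G.Adj u x ∧ G.Adj u y)
    (hc : ∀ v, ConnSet G {v}ᶜ) : KConnected 2 G := by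
  intro u w huw
  have hlink : Linked G u w := by
    have := (hc u).eq_of_closed (T := {w | w ≠ u ∧ Linked G u w}) (fun w hw => hw.1) ?_ ?_
    · have hw : w ∈ ({u}ᶜ : Set V) := huw.symm
      rw [← this] at hw
      exact hw.2
    · obtain ⟨w', -, -, hw', -⟩ := h2 u
      obtain ⟨y, hyu, hy⟩ : ∃ y, y ≠ u ∧ G.Adj w' y := by
        obtain ⟨x, y, hxy, hx, hy⟩ := h2 w'
        by_cases h : x = u
        · exact ⟨y, fun h' => hxy (h.trans h'.symm), hy⟩
        · exact ⟨x, h, hx⟩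
      obtain ⟨r, hr, hrw⟩ := (hc w').exists_path (a := u) (b := y) hw'.ne hy.ne'
      refine ⟨w', hw'.ne', Walk.cons hw' Walk.nil, r.concat hy.symm, fun h => ?_, ?_,
        hr.concat (fun h => hrw w' h rfl) _, ?_⟩
      · have : y ∈ (r.concat hy.symm).support := by simp [Walk.support_concat]
        rw [← h] at this
        simp [hyu, hy.ne'] at this
      · simp [hw'.ne]
      · intro x hx _
        simpa using hx
    · rintro a ⟨hau, ha⟩ b hb hab
      exact ⟨hb, ha.of_adj (hc a) (Ne.symm hau) hab hb⟩
  obtain ⟨p, q, hne, hp, hq, hpq⟩ := hlink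
  refine ⟨![p, q], ?_, ?_, ?_⟩
  · intro i j
    fin_cases i <;> fin_cases j <;> simp [hne, hne.symm]
  · intro i
    fin_cases i <;> simp [hp, hq]
  · intro i j
    fin_cases i <;> fin_cases j <;> simp
    · exact hpq
    · exact fun x h1 h2 => hpq x h2 h1

theorem isMinorOf_induce (U : Set V) : IsMinorOf (G.induce U) G := by
  refine ⟨fun w => {w.1}, fun w => connSet_iff.1 (connSet_singleton _), fun w w' h => ?_,
    fun w w' h => ⟨w, rfl, w', rfl, h⟩⟩
  simpa using fun h' => h (Subtype.ext h')

theorem ConnSet.exists_adj {S : Set V} (hS : ConnSet G S) {v : V} (hv : v ∈ S) (hne : S ≠ {v}) :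
    ∃ w ∈ S, w ≠ v ∧ G.Adj v w := by
  by_contra hcon
  push Not at hcon
  refine hne (hS.eq_of_closed (T := {v}) (by simpa using hv) ⟨v, rfl⟩ ?_).symm
  rintro _ rfl b hb hab
  exact absurd hab (hcon b hb hab.ne')

theorem ObsApexPseudoforest.exists_of_ne_univ [Finite V] (h : ObsApexPseudoforest G) {U : Set V}
    (hU : U ≠ Set.univ) :
    ∃ s : Set V, s.Subsingleton ∧ ∀ S ⊆ U \ s, ConnSet G S → rk G S ≤ 2 := by
  have hiso : IsEmpty (G.induce U ≃g G) := by
    refine ⟨fun e => hU ?_⟩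
    have := Nat.card_congr e.toEquiv
    rw [Nat.card_coe_set_eq] at this
    rwa [Set.eq_univ_iff_ncard]
  obtain ⟨s, hs, hS⟩ := apexPseudoforest_iff.1 (h.2 _ _ (isMinorOf_induce U) hiso)
  let f : G.induce U ↪g G := SimpleGraph.Embedding.induce U
  refine ⟨f '' s, hs.image f, fun S hSU hc => ?_⟩
  have he : S = f '' {x | x.1 ∈ S} := by
    ext x
    constructor
    · intro hx
      exact ⟨⟨x, (hSU hx).1⟩, hx, rfl⟩
    · rintro ⟨y, hy, rfl⟩
      exact hy
  rw [he, rk_image]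
  rw [he, connSet_image_iff] at hc
  exact hS _ (fun x hx hxs => (hSU hx).2 ⟨x, hxs, rfl⟩) hc

theorem ObsApexPseudoforest.exists_two_adj [Finite V] (h : ObsApexPseudoforest G) (u : V) :
    ∃ x y, x ≠ y ∧ G.Adj u x ∧ G.Adj u y := by
  by_contra hcon
  push Not at hcon
  obtain ⟨s, hs, hS⟩ := h.exists_of_ne_univ (U := {u}ᶜ) (by simp)
  refine h.1 (apexPseudoforest_iff.2 ⟨s, hs, fun S hSs hc => ?_⟩)
  by_cases hu : u ∈ S
  · by_cases h' : S = {u}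
    · rw [h', rk_singleton]
      norm_num
    · obtain ⟨x, hx, -, hux⟩ := hc.exists_adj hu h'
      have hcl := hc.diff_comp (A := {x}) (K := {u}) (connSet_singleton x) (by simpa using hx)
        (by simpa using hux.ne) (by
          rintro a rfl b hb hab
          exact absurd hab (hcon x b (fun h => hb.2 h.symm) hux))
      have hr := hS _ (fun y hy => ⟨hy.2, hSs hy.1⟩) hcl
      have he : S = (S \ {u}) ∪ {u} := (Set.sdiff_union_of_subset (by simpa using hu)).symm
      rw [he, rk_add_singleton (by simp)]
      by_cases h2 : 2 ≤ (crossing G (S \ {u}) {u}).ncard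
      · obtain ⟨a, -, b, -, hab, ha, hb⟩ := exists_two_neighbors h2
        exact absurd hb.symm (hcon a b hab ha.symm)
      · omega
  · exact hS S (fun x hx => ⟨fun hxu => hu (by rwa [← show x = u from hxu]), hSs hx⟩) hc

theorem ConnSet.db [Finite V] {S : Set V} (hS : ConnSet G S) (h : 4 ≤ rk G S) : DB G S := by
  by_contra hcon
  have := hS.rk_le_two hcon
  omega

/-- A connected set all of whose vertices, except possibly one, have two neighbours inside it
contains a cycle. -/
theorem ConnSet.cyc [Finite V] {D : Set V} (hD : ConnSet G D) {v : V} (hv : v ∈ D) (hne : D ≠ {v})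
    (h2 : ∀ x ∈ D, x ≠ v → ∃ y ∈ D, ∃ z ∈ D, y ≠ z ∧ G.Adj x y ∧ G.Adj x z) : Cyc G D := by
  induction hn : D.ncard using Nat.strong_induction_on generalizing D v with
  | _ n ih =>
  obtain ⟨w, hwD, hwv, hvw⟩ := hD.exists_adj hv hne
  obtain ⟨K, hwK, hKD, hK, hKcl⟩ := (connSet_singleton (G := G) w).exists_comp (U := D \ {v})
    (by simpa using ⟨hwD, hwv⟩)
  replace hwK : w ∈ K := hwK rfl
  by_cases hw' : ∃ w' ∈ K, w' ≠ w ∧ G.Adj v w'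
  · obtain ⟨w', hw', hne', hvw'⟩ := hw'
    obtain ⟨X, Y, rfl, hXY, hwX, hwY, hX, hY, ht⟩ := hK.split hwK hw' hne'.symm
    refine ⟨{v}, X, Y, ?_, ⟨connSet_singleton v, hX, hY⟩, ⟨?_, ?_, hXY⟩,
      ⟨v, rfl, w, hwX, hvw⟩, ⟨v, rfl, w', hwY, hvw'⟩, ht⟩
    · rw [Set.union_assoc]
      exact Set.union_subset (by simpa using hv) (hKD.trans Set.sdiff_subset)
    · simpa using fun h => (hKD (.inl h)).2 rfl
    · simpa using fun h => (hKD (.inr h)).2 rfl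
  · push Not at hw'
    refine (ih K.ncard ?_ hK hwK ?_ ?_ rfl).mono (hKD.trans Set.sdiff_subset)
    · rw [← hn]
      exact Set.ncard_lt_ncard ⟨hKD.trans Set.sdiff_subset, fun hs => (hKD (hs hv)).2 rfl⟩
        (Set.toFinite _)
    · rintro rfl
      obtain ⟨y, hy, z, hz, hyz, hwy, hwz⟩ := h2 w hwD hwv
      have aux : ∀ y ∈ D, G.Adj w y → y = v := fun y hy hwy => by
        by_contra h
        exact hwy.ne' (hKcl w rfl y ⟨hy, h⟩ hwy)
      exact hyz ((aux y hy hwy).trans (aux z hz hwz).symm)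
    · intro x hx hxw
      obtain ⟨y, hy, z, hz, hyz, hxy, hxz⟩ := h2 x (hKD hx).1 (hKD hx).2
      have aux : ∀ y ∈ D, G.Adj x y → y ∈ K := fun y hy hxy =>
        hKcl x hx y ⟨hy, fun h => hw' x hx hxw (h ▸ hxy.symm)⟩ hxy
      exact ⟨y, aux y hy hxy, z, aux z hz hxz, hyz, hxy, hxz⟩

theorem connSet_univ_of_obs [Finite V] (h1 : ObsApexPseudoforest G) (h2 : ¬ InO G) :
    ConnSet G Set.univ := by
  obtain ⟨S, -, hS, hSr⟩ := not_apexPseudoforest_iff.1 h1.1 ∅ Set.subsingleton_empty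
  obtain ⟨C, hSC, -, hC, hCcl⟩ := hS.exists_comp (Set.subset_univ S)
  by_cases hU : C = Set.univ
  · rwa [← hU]
  obtain ⟨s, hs, hsC⟩ := h1.exists_of_ne_univ hU
  obtain ⟨T, hTs, hT, hTr⟩ := not_apexPseudoforest_iff.1 h1.1 s hs
  by_cases hd : Disjoint S T
  · exact (not_DB_DB (fun n H => not_isMinorOf_of_obs h1 h2) (hS.db hSr) (hT.db hTr) hd).elim
  obtain ⟨x, hxS, hxT⟩ := Set.not_disjoint_iff.1 hd
  have hTC : T ∩ C = T := hT.eq_of_closed Set.inter_subset_left ⟨x, hxT, hSC hxS⟩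
    fun a ha b hb hab => ⟨hb, hCcl a ha.2 b trivial hab⟩
  have := hsC T (fun a ha => ⟨Set.inter_eq_left.1 hTC ha, hTs ha⟩) hT
  omega

/-- `v` is a cut vertex separating the connected set `W`, of large cycle rank, from the
rest of the graph. -/
structure CutSide (G : SimpleGraph V) (v : V) (W : Set V) : Prop where
  notMem : v ∉ W
  conn : ConnSet G W
  conn_compl : ConnSet G Wᶜ
  closed : ∀ a ∈ W, ∀ b ∉ W, G.Adj a b → b = v
  rank : 4 ≤ rk G W
  compl_ne : Wᶜ ≠ {v}

theorem CutSide.of_comp [Finite V] (hU : ConnSet G Set.univ) {S W : Set V} {v : V}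
    (hS : ConnSet G S) (hSr : 4 ≤ rk G S) (hSW : S ⊆ W) (hWv : W ⊆ {v}ᶜ) (hW : ConnSet G W)
    (hcl : ∀ a ∈ W, ∀ b ∈ ({v}ᶜ : Set V), G.Adj a b → b ∈ W) (hne : W ≠ {v}ᶜ) : CutSide G v W := by
  have hvW : v ∉ W := fun h => hWv h rfl
  refine ⟨hvW, hW, ?_, fun a ha b hb hab => ?_, hSr.trans (hS.rk_mono hW hSW), ?_⟩
  · rw [Set.compl_eq_univ_sdiff]
    exact hU.diff_comp (connSet_singleton v) (Set.subset_univ _) (by simpa using hvW)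
      fun a ha b hb => hcl a ha b hb.2
  · by_contra h
    exact hb (hcl a ha b h hab)
  · exact fun h => hne (by rw [← h, compl_compl])

theorem CutSide.rich [Finite V] (hU : ConnSet G Set.univ) (hna : ¬ ApexPseudoforest G) {v : V}
    {W : Set V} (h : CutSide G v W) (hmin : ∀ x T, CutSide G x T → W.ncard ≤ T.ncard)
    (hD : rk G Wᶜ ≤ 2) {x : V} (hx : x ∈ W) :
    ∃ K ⊆ W, x ∉ K ∧ ConnSet G K ∧ Rich G v K := by
  obtain ⟨S, hSx, hS, hSr⟩ := not_apexPseudoforest_iff.1 hna {x} Set.subsingleton_singleton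
  obtain ⟨T₀, hST, hTx, hT, hTcl⟩ := hS.exists_comp hSx
  have hxT : x ∉ T₀ := fun h => hTx h rfl
  have hTr : 4 ≤ rk G T₀ := hSr.trans (hS.rk_mono hT hST)
  have hWT : (T₀ ∩ Wᶜ).Nonempty → Wᶜ ⊆ T₀ := fun hne => by
    have := h.conn_compl.eq_of_closed (T := T₀ ∩ Wᶜ) Set.inter_subset_right hne
      fun a ha b hb hab => ⟨hTcl a ha.1 b (fun hbx => hb (hbx ▸ hx)) hab, hb⟩
    exact Set.inter_eq_right.1 this
  have hsub : Wᶜ ⊆ T₀ := by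
    by_contra hcon
    have hTW : T₀ ⊆ W := fun a ha => by
      by_contra haW
      exact hcon (hWT ⟨a, ha, haW⟩)
    have hlt : T₀.ncard < W.ncard :=
      Set.ncard_lt_ncard ⟨hTW, fun hs => hxT (hs hx)⟩ (Set.toFinite _)
    refine hlt.not_ge (hmin x T₀ (.of_comp hU hS hSr hST hTx hT hTcl fun he => ?_))
    have hvT : v ∈ T₀ := by
      rw [he]
      exact fun hvx => h.notMem (hvx ▸ hx)
    exact h.notMem (hTW hvT)
  obtain ⟨T, hTT, hTm⟩ := Set.Finite.exists_le_minimal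
    (Set.toFinite {T : Set V | Wᶜ ⊆ T ∧ ConnSet G T ∧ 4 ≤ rk G T}) ⟨hsub, hT, hTr⟩
  obtain ⟨hDT, hT', hTr'⟩ := hTm.prop
  obtain ⟨y, hyT, hyD⟩ : ∃ y ∈ T, y ∉ Wᶜ := by
    by_contra hcon
    push Not at hcon
    rw [Set.Subset.antisymm hcon hDT] at hTr'
    omega
  obtain ⟨K, hyK, hKT, hK, hKcl⟩ := (connSet_singleton (G := G) y).exists_comp (U := T \ Wᶜ)
    (by simpa using ⟨hyT, by simpa using hyD⟩)
  replace hyK : y ∈ K := hyK rfl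
  have hKW : K ⊆ W := fun a ha => by simpa using (hKT ha).2
  have hKsub : K ⊆ T := fun a ha => (hKT ha).1
  have hdiff : ConnSet G (T \ K) := hT'.diff_comp h.conn_compl hDT
    (disjoint_compl_right.mono_left hKW) hKcl
  have hdr : rk G (T \ K) ≤ 2 := by
    by_contra hcon
    have he := rk_even _ hdiff
    have hsub : T ⊆ T \ K := hTm.le_of_le (y := T \ K)
      ⟨fun a ha => ⟨hDT ha, fun haK => ha (hKW haK)⟩, hdiff, by grind⟩ Set.sdiff_subset
    exact (hsub hyT).2 hyK
  have hv : ∀ a ∈ K, ∀ b ∈ T \ K, G.Adj a b → b = v := fun a ha b hb hab =>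
    h.closed a (hKW ha) b (fun hbW => hb.2 (hKcl a ha b ⟨hb.1, fun h => h hbW⟩ hab)) hab
  refine ⟨K, hKW, fun hxK => hxT (hTT (hKsub hxK)), hK, ?_⟩
  have hrk := rk_union (G := G) (X := K) (Y := T \ K) Set.disjoint_sdiff_right
  rw [Set.union_sdiff_cancel hKsub] at hrk
  by_cases h2 : 2 ≤ (crossing G K (T \ K)).ncard
  · obtain ⟨a, ha, b, hb, a', ha', b', hb', hab, hab', hne⟩ := exists_two_of_crossing h2
    have e1 := hv a ha b hb hab
    have e2 := hv a' ha' b' hb' hab'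
    subst e1
    subst e2
    exact .inl ⟨a, ha, a', ha', by simpa using hne, ⟨_, rfl, hab⟩, _, rfl, hab'⟩
  · right
    constructor
    · have hvT : v ∈ T \ K := ⟨hDT h.notMem, fun hvK => h.notMem (hKW hvK)⟩
      obtain ⟨a, ha, b, hb, hab⟩ := hT'.touch_diff hKsub ⟨y, hyK⟩ ⟨v, hvT⟩
      exact ⟨a, ha, v, rfl, hv a ha b hb hab ▸ hab⟩
    · by_contra hc
      have := hK.rk_le_zero hc
      omega

theorem connSet_compl_singleton [Finite V] (h1 : ObsApexPseudoforest G) (h2 : ¬ InO G) (v : V) :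
    ConnSet G {v}ᶜ := by
  by_contra hcon
  have hU := connSet_univ_of_obs h1 h2
  have hsep : ∃ W, CutSide G v W := by
    obtain ⟨S, hSv, hS, hSr⟩ := not_apexPseudoforest_iff.1 h1.1 {v} Set.subsingleton_singleton
    obtain ⟨W, hSW, hWv, hW, hcl⟩ := hS.exists_comp hSv
    exact ⟨W, .of_comp hU hS hSr hSW hWv hW hcl fun he => hcon (he ▸ hW)⟩
  clear hcon
  obtain ⟨W, hW⟩ := hsep
  obtain ⟨⟨v, W⟩, hW, hmin⟩ := Set.exists_min_image {p : V × Set V | CutSide G p.1 p.2}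
    (fun p => p.2.ncard) (Set.toFinite _) ⟨(v, W), hW⟩
  replace hW : CutSide G v W := hW
  have hex := fun n (H : SimpleGraph (Fin n)) => not_isMinorOf_of_obs h1 h2 (H := H)
  have hD : rk G Wᶜ ≤ 2 := hW.conn_compl.rk_le_two fun hDB =>
    not_DB_DB hex (hW.conn.db hW.rank) hDB disjoint_compl_right
  have hcyc : Cyc G Wᶜ := hW.conn_compl.cyc hW.notMem hW.compl_ne fun x hx hxv => by
    obtain ⟨y, z, hyz, hxy, hxz⟩ := h1.exists_two_adj x
    have aux : ∀ y, G.Adj x y → y ∈ Wᶜ := fun y hxy hy => hxv (hW.closed y hy x hx hxy.symm)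
    exact ⟨y, aux y hxy, z, aux z hxz, hyz, hxy, hxz⟩
  obtain ⟨A, B, C, hABC, ht, hvA⟩ := hcyc.spanning_at hW.conn_compl hW.notMem
  have hd : Disjoint W (A ∪ B ∪ C) := hABC ▸ disjoint_compl_right
  simp only [Set.disjoint_union_right] at hd
  exact (Lobe.mk hex hW.conn ht hvA hd.1.1 hd.1.2 hd.2).elim hW.rank fun x hx =>
    hW.rich hU h1.1 (fun x T hT => hmin (x, T) hT) hD hx

end

/-- Every obstruction for apex-pseudoforests not isomorphic to a member of `O`
is `K₂,₃`-minor-free or biconnected. -/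
theorem obstruction_K23_or_biconnected {V : Type} [Finite V] (G : SimpleGraph V)
    (h1 : ObsApexPseudoforest G) (h2 : ¬ InO G) :
    ¬ IsMinorOf (completeBipartiteGraph (Fin 2) (Fin 3)) G ∨ KConnected 2 G :=
  .inr (kConnected_two h1.exists_two_adj (connSet_compl_singleton h1 h2))
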